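/- arXiv:2112.02369 — 4 statements merged into one kernel-verified Lean document; each statement's English description precedes it below -/
import Mathlib

section
/- Let n ≥ 3 and let w > 1. Then v_{11}² = ( 2 + (8/(n−1)) · Σ_{ℓ=1}^{⌈(n−1)/2⌉} sin²((2ℓ−1)π/(n−1)) / (λ₁(w) − 2cos((2ℓ−1)π/(n−1)))² )^{−1} and v_{12}² = ( 2 + (8/(n−1)) · Σ_{ℓ=1}^{⌈(n−2)/2⌉} sin²(2ℓπ/(n−1)) / (λ₂(w) − 2cos(2ℓπ/(n−1)))² )^{−1}. -/
open Polynomial Real Filter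

noncomputable def pathA (n : ℕ) (w : ℝ) : Matrix (Fin n) (Fin n) ℝ :=
  Matrix.of fun i j =>
    if i = j ∧ (i.val = 0 ∨ i.val = n - 1) then w
    else if i.val + 1 = j.val ∨ j.val + 1 = i.val then 1
    else 0

/-- `μ` lists the eigenvalues of `pathA n w` with multiplicity, in decreasing order. -/
def IsEigList (n : ℕ) (w : ℝ) (μ : Fin n → ℝ) : Prop :=
  Antitone μ ∧ (pathA n w).charpoly = ∏ i, (Polynomial.X - Polynomial.C (μ i))

theorem two_sin_half_mul_sum_cos (M : ℕ) (φ : ℝ) :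
    2 * sin (φ / 2) * ∑ k ∈ Finset.Icc 1 M, cos (k * φ) =
      sin (M * φ + φ / 2) - sin (φ / 2) := by
  induction M with
  | zero => simp
  | succ M ih =>
    rw [Finset.sum_Icc_succ_top (by omega), mul_add, ih]
    have h : (M : ℝ) * φ + φ / 2 = ((M + 1 : ℕ) : ℝ) * φ - φ / 2 := by push_cast; ring
    rw [h, sin_sub, sin_add]
    ring

theorem sum_cos_nat_mul_pi_div {N m : ℕ} (hm : 0 < m) (hmN : m < 2 * N) :
    ∑ k ∈ Finset.Icc 1 N, cos (k * (m * π / N)) = ((-1) ^ m - 1) / 2 := by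
  have hN : (0 : ℝ) < N := by exact_mod_cast (by omega : 0 < N)
  have hm' : (0 : ℝ) < m := by exact_mod_cast hm
  have hmN' : (m : ℝ) < 2 * N := by exact_mod_cast hmN
  have hpos : 0 < sin (m * π / N / 2) := by
    apply sin_pos_of_pos_of_lt_pi
    · positivity
    · rw [div_div, div_lt_iff₀ (by positivity)]
      nlinarith [pi_pos]
  have key := two_sin_half_mul_sum_cos N (m * π / N)
  have h : (N : ℝ) * (m * π / N) + m * π / N / 2 = m * π / N / 2 + m * π := by
    field_simp
    ring
  rw [h, sin_add_nat_mul_pi] at key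
  apply mul_left_cancel₀ (mul_pos two_pos hpos).ne'
  rw [key]
  ring

theorem sum_sin_mul_sin {N i j : ℕ} (hi : 0 < i) (hiN : i < N) (hj : 0 < j) (hjN : j < N) :
    ∑ k ∈ Finset.Icc 1 N, sin (i * (k * π / N)) * sin (j * (k * π / N)) =
      if i = j then (N : ℝ) / 2 else 0 := by
  wlog hij : i ≤ j generalizing i j
  · rw [← if_congr (eq_comm (a := j) (b := i)) rfl rfl, ← this hj hjN hi hiN (by omega)]
    exact Finset.sum_congr rfl fun k _ => mul_comm _ _
  have hprod : ∀ k : ℕ, sin (i * (k * π / N)) * sin (j * (k * π / N)) =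
      (cos (k * ((j - i : ℕ) * π / N)) - cos (k * ((i + j : ℕ) * π / N))) / 2 := by
    intro k
    have h1 : (k : ℝ) * ((j - i : ℕ) * π / N) = j * (k * π / N) - i * (k * π / N) := by
      push_cast [hij]; ring
    have h2 : (k : ℝ) * ((i + j : ℕ) * π / N) = j * (k * π / N) + i * (k * π / N) := by
      push_cast; ring
    rw [h1, h2, cos_sub, cos_add]
    ring
  simp_rw [hprod]
  rw [← Finset.sum_div, Finset.sum_sub_distrib,
    sum_cos_nat_mul_pi_div (m := i + j) (by omega) (by omega)]
  split_ifs with h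
  · subst h
    simp [← two_mul, pow_mul]
  · rw [sum_cos_nat_mul_pi_div (m := j - i) (by omega) (by omega)]
    have : i + j = (j - i) + 2 * i := by omega
    rw [this, pow_add, pow_mul]
    simp

/-- Parseval's identity for the discrete sine transform. -/
theorem sum_sq_eq_sum_sq_sine_transform (P : ℕ) (V : ℕ → ℝ) :
    ∑ i ∈ Finset.range P, V (i + 1) ^ 2 = 2 / ((P : ℝ) + 1) * ∑ k ∈ Finset.Icc 1 (P + 1),
      (∑ i ∈ Finset.range P, V (i + 1) * sin ((i + 1 : ℕ) * (k * π / (P + 1 : ℕ)))) ^ 2 := by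
  have hP : (P : ℝ) + 1 ≠ 0 := by positivity
  have h : ∑ k ∈ Finset.Icc 1 (P + 1),
      (∑ i ∈ Finset.range P, V (i + 1) * sin ((i + 1 : ℕ) * (k * π / (P + 1 : ℕ)))) ^ 2 =
      ∑ i ∈ Finset.range P, ((P : ℝ) + 1) / 2 * V (i + 1) ^ 2 := by
    simp_rw [pow_two (Finset.sum _ _), Finset.sum_mul_sum]
    rw [Finset.sum_comm]
    refine Finset.sum_congr rfl fun i hi => ?_
    rw [Finset.sum_comm]
    have hi' := Finset.mem_range.1 hi
    have h1 : ∀ j ∈ Finset.range P, ∑ k ∈ Finset.Icc 1 (P + 1),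
        V (i + 1) * sin ((i + 1 : ℕ) * (k * π / (P + 1 : ℕ))) *
          (V (j + 1) * sin ((j + 1 : ℕ) * (k * π / (P + 1 : ℕ)))) =
        if i = j then ((P : ℝ) + 1) / 2 * V (i + 1) ^ 2 else 0 := by
      intro j hj
      have hj' := Finset.mem_range.1 hj
      have := sum_sin_mul_sin (N := P + 1) (i := i + 1) (j := j + 1)
        (by omega) (by omega) (by omega) (by omega)
      simp_rw [mul_mul_mul_comm]
      rw [← Finset.mul_sum, this]
      by_cases hij : i = j
      · subst hij
        simp only [if_true]
        push_cast
        ring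
      · simp [hij]
    rw [Finset.sum_congr rfl h1]
    simp [hi']
  rw [h, ← Finset.mul_sum]
  field_simp

/-- Discrete Green identity for two solutions of three-term recurrences. -/
theorem sub_mul_sum_mul_eq_wronskian (P : ℕ) (V s : ℕ → ℝ) (lam μ : ℝ)
    (hV : ∀ i < P, lam * V (i + 1) = V i + V (i + 2))
    (hs : ∀ i, μ * s (i + 1) = s i + s (i + 2)) :
    (lam - μ) * ∑ i ∈ Finset.range P, V (i + 1) * s (i + 1) =
      (V (P + 1) * s P - V P * s (P + 1)) - (V 1 * s 0 - V 0 * s 1) := by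
  induction P with
  | zero => simp
  | succ P ih =>
    rw [Finset.sum_range_succ, mul_add, ih fun i hi => hV i (by omega)]
    linear_combination s (P + 1) * hV P (by omega) - V (P + 1) * hs P

theorem sin_reflect (P k i : ℕ) (hi : i ≤ P + 1) :
    sin ((P + 1 - i : ℕ) * (k * π / (P + 1 : ℕ))) =
      -(-1) ^ k * sin (i * (k * π / (P + 1 : ℕ))) := by
  have h : ((P + 1 - i : ℕ) : ℝ) * (k * π / (P + 1 : ℕ)) =
      -(i * (k * π / (P + 1 : ℕ))) + k * π := by
    have : (P : ℝ) + 1 ≠ 0 := by positivity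
    push_cast [hi]
    field_simp
    ring
  rw [h, sin_add_nat_mul_pi, sin_neg]
  ring

theorem sine_coeff_sq (P : ℕ) (V : ℕ → ℝ) (lam ε : ℝ) (hε : ε = 1 ∨ ε = -1)
    (hV : ∀ i < P, lam * V (i + 1) = V i + V (i + 2))
    (hsym : ∀ i ≤ P + 1, V (P + 1 - i) = ε * V i) (h0 : V 0 ≠ 0)
    (k : ℕ) :
    (∑ i ∈ Finset.range P, V (i + 1) * sin ((i + 1 : ℕ) * (k * π / (P + 1 : ℕ)))) ^ 2 =
      if (-1) ^ k = -ε then V 0 ^ 2 * 4 * (sin (k * π / (P + 1 : ℕ)) ^ 2 /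
        (lam - 2 * cos (k * π / (P + 1 : ℕ))) ^ 2) else 0 := by
  set θ : ℝ := k * π / (P + 1 : ℕ) with hθ
  split_ifs with hk
  · have hs : ∀ i : ℕ, 2 * cos θ * sin ((i + 1 : ℕ) * θ) =
        sin (i * θ) + sin ((i + 2 : ℕ) * θ) := by
      intro i
      have h1 : (i : ℝ) * θ = (i + 1 : ℕ) * θ - θ := by push_cast; ring
      have h2 : ((i + 2 : ℕ) : ℝ) * θ = (i + 1 : ℕ) * θ + θ := by push_cast; ring
      rw [h1, h2, sin_sub, sin_add]
      ring
    have key := sub_mul_sum_mul_eq_wronskian P V (fun i => sin (i * θ)) lam (2 * cos θ) hV hs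
    have hP := sin_reflect P k 1 (by omega)
    have hP1 := sin_reflect P k 0 (by omega)
    have hend := hsym 0 (by omega)
    rw [← hθ] at hP hP1
    simp only [Nat.add_sub_cancel, Nat.sub_zero, hk, Nat.cast_zero, zero_mul, sin_zero,
      mul_zero, Nat.cast_one, one_mul, neg_neg] at hP hP1 hend key
    rw [hP, hP1, hend] at key
    have hε2 : ε * ε = 1 := by rcases hε with h | h <;> simp [h]
    have key' : (lam - 2 * cos θ) *
        ∑ i ∈ Finset.range P, V (i + 1) * sin ((i + 1 : ℕ) * θ) = 2 * V 0 * sin θ := by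
      rw [key]
      linear_combination V 0 * sin θ * hε2
    by_cases hd : lam - 2 * cos θ = 0
    · have hsin : sin θ = 0 := by
        rw [hd, zero_mul] at key'
        have := mul_eq_zero.1 key'.symm
        simpa [h0] using this
      have hz : ∀ i : ℕ, sin (i * θ) = 0 := by
        intro i
        induction i with
        | zero => simp
        | succ i ih => push_cast; rw [add_mul, one_mul, sin_add, ih, hsin]; simp
      simp only [hz, hsin]
      simp
    · have h := eq_div_of_mul_eq hd ((mul_comm _ _).trans key')
      rw [h, div_pow]
      ring
  · have hrefl := Finset.sum_range_reflect
      (fun i => V (i + 1) * sin ((i + 1 : ℕ) * θ)) P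
    have hflip : ∑ i ∈ Finset.range P, V (P - 1 - i + 1) * sin ((P - 1 - i + 1 : ℕ) * θ) =
        (ε * -(-1) ^ k) * ∑ i ∈ Finset.range P, V (i + 1) * sin ((i + 1 : ℕ) * θ) := by
      rw [Finset.mul_sum]
      refine Finset.sum_congr rfl fun i hi => ?_
      have hi' := Finset.mem_range.1 hi
      have e : P - 1 - i + 1 = P + 1 - (i + 1) := by omega
      rw [e, hsym (i + 1) (by omega), sin_reflect P k (i + 1) (by omega)]
      ring
    have hneg : ε * -(-1) ^ k = -1 := by
      rcases hε with h | h <;> rcases neg_one_pow_eq_or ℝ k with h' | h' <;>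
        simp [h, h'] at hk ⊢
    rw [hflip, hneg] at hrefl
    rw [show ∑ i ∈ Finset.range P, V (i + 1) * sin ((i + 1 : ℕ) * θ) = 0 by linarith]
    simp

theorem sq_head_mul_eq_one (P : ℕ) (V : ℕ → ℝ) (lam ε : ℝ) (hε : ε = 1 ∨ ε = -1)
    (hV : ∀ i < P, lam * V (i + 1) = V i + V (i + 2))
    (hsym : ∀ i ≤ P + 1, V (P + 1 - i) = ε * V i) (h0 : V 0 ≠ 0)
    (hunit : ∑ i ∈ Finset.range (P + 2), V i ^ 2 = 1) :
    V 0 ^ 2 * (2 + 8 / ((P + 1 : ℕ) : ℝ) * ∑ k ∈ Finset.Icc 1 (P + 1) with (-1) ^ k = -ε,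
      sin (k * π / (P + 1 : ℕ)) ^ 2 / (lam - 2 * cos (k * π / (P + 1 : ℕ))) ^ 2) = 1 := by
  rw [Finset.sum_range_succ, Finset.sum_range_succ', sum_sq_eq_sum_sq_sine_transform] at hunit
  simp_rw [sine_coeff_sq P V lam ε hε hV hsym h0] at hunit
  rw [← Finset.sum_filter, ← Finset.mul_sum] at hunit
  have hend := hsym 0 (by omega)
  have hε2 : ε * ε = 1 := by rcases hε with h | h <;> simp [h]
  rw [Nat.sub_zero] at hend
  rw [hend] at hunit
  push_cast at hunit ⊢
  linear_combination hunit - V 0 ^ 2 * hε2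

open Matrix

section Spectral

variable {n : ℕ} {A : Matrix (Fin n) (Fin n) ℝ} {μ : Fin n → ℝ}

/-- A real symmetric matrix whose eigenspaces contain no two orthogonal nonzero vectors has simple
spectrum, and an orthonormal eigenbasis in any prescribed order of the eigenvalues. -/
theorem exists_orthonormalBasis_of_charpoly_eq (hA : A.IsHermitian)
    (hchar : A.charpoly = ∏ i, (X - C (μ i)))
    (hsimple : ∀ (lam : ℝ) (u v : Fin n → ℝ), A *ᵥ u = lam • u → A *ᵥ v = lam • v →
      u ⬝ᵥ v = 0 → u = 0 ∨ v = 0) :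
    Function.Injective μ ∧ ∃ b : OrthonormalBasis (Fin n) ℝ (EuclideanSpace ℝ (Fin n)),
      ∀ i, A *ᵥ (b i).ofLp = μ i • (b i).ofLp := by
  have heig : Function.Injective hA.eigenvalues := by
    intro i j hij
    by_contra hne
    have hi := hA.mulVec_eigenvectorBasis i
    have hj := hA.mulVec_eigenvectorBasis j
    rw [← hij] at hj
    have horth : (hA.eigenvectorBasis i).ofLp ⬝ᵥ (hA.eigenvectorBasis j).ofLp = 0 := by
      have := hA.eigenvectorBasis.inner_eq_zero (Ne.symm hne)
      simpa [EuclideanSpace.inner_eq_star_dotProduct] using this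
    rcases hsimple _ _ _ hi hj horth with h | h
    · exact hA.eigenvectorBasis.orthonormal.ne_zero i (by ext k; simpa using congrFun h k)
    · exact hA.eigenvectorBasis.orthonormal.ne_zero j (by ext k; simpa using congrFun h k)
  have hroots : Finset.univ.val.map μ = Finset.univ.val.map hA.eigenvalues := by
    have h1 := hA.roots_charpoly_eq_eigenvalues
    rw [hchar, Polynomial.roots_prod _ _ (Finset.prod_ne_zero_iff.2 fun i _ => X_sub_C_ne_zero _)]
      at h1
    simpa using h1
  have hinj : Function.Injective μ := by
    have hnodup : (Finset.univ.val.map μ).Nodup := by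
      rw [hroots]
      exact Finset.univ.nodup.map heig
    intro i j hij
    exact Multiset.inj_on_of_nodup_map hnodup i (Finset.mem_univ i) j (Finset.mem_univ j) hij
  refine ⟨hinj, ?_⟩
  have hex : ∀ i, ∃ j, hA.eigenvalues j = μ i := by
    intro i
    have : μ i ∈ Finset.univ.val.map hA.eigenvalues := by
      rw [← hroots]
      exact Multiset.mem_map_of_mem _ (Finset.mem_univ i)
    simpa using this
  choose σ hσ using hex
  have hσinj : Function.Injective σ := fun i j hij => hinj (by rw [← hσ i, ← hσ j, hij])
  let e : Fin n ≃ Fin n := Equiv.ofBijective σ (Finite.injective_iff_bijective.1 hσinj)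
  refine ⟨hA.eigenvectorBasis.reindex e.symm, fun i => ?_⟩
  have := hA.mulVec_eigenvectorBasis (σ i)
  rw [hσ i] at this
  simpa [e] using this

/-- Equality case of the Courant–Fischer bound. -/
theorem mulVec_eq_smul_of_le_dotProduct_mulVec (hA : A.IsHermitian) (hμ : Antitone μ)
    (b : OrthonormalBasis (Fin n) ℝ (EuclideanSpace ℝ (Fin n)))
    (hb : ∀ i, A *ᵥ (b i).ofLp = μ i • (b i).ofLp) (k : Fin n) (x : Fin n → ℝ)
    (horth : ∀ i < k, (b i).ofLp ⬝ᵥ x = 0) (hx : μ k * (x ⬝ᵥ x) ≤ x ⬝ᵥ A *ᵥ x) :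
    A *ᵥ x = μ k • x := by
  set c : Fin n → ℝ := fun i => (b i).ofLp ⬝ᵥ x with hc
  have hexp : ∀ y : Fin n → ℝ, y = ∑ i, ((b i).ofLp ⬝ᵥ y) • (b i).ofLp := by
    intro y
    have h := b.sum_repr' (WithLp.toLp 2 y)
    have h2 := congrArg WithLp.ofLp h
    simp only [WithLp.ofLp_sum, WithLp.ofLp_smul, EuclideanSpace.inner_eq_star_dotProduct,
      star_trivial] at h2
    rw [← h2]
    refine Finset.sum_congr rfl fun i _ => ?_
    rw [h2, dotProduct_comm]
  have hdot : ∀ y : Fin n → ℝ, x ⬝ᵥ y = ∑ i, ((b i).ofLp ⬝ᵥ y) * c i := by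
    intro y
    conv_lhs => rw [hexp y, dotProduct_sum]
    exact Finset.sum_congr rfl fun i _ => by rw [dotProduct_smul, dotProduct_comm x, smul_eq_mul]
  have hAc : ∀ i, (b i).ofLp ⬝ᵥ A *ᵥ x = μ i * c i := by
    intro i
    have hsymm : Aᵀ = A := by simpa [Matrix.IsHermitian] using hA
    rw [dotProduct_mulVec, ← mulVec_transpose, hsymm, hb i, smul_dotProduct, smul_eq_mul]
  have hnonneg : ∀ i ∈ Finset.univ, 0 ≤ (μ k - μ i) * (c i * c i) := by
    intro i _
    rcases lt_or_ge i k with h | h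
    · simp [hc, horth i h]
    · exact mul_nonneg (sub_nonneg.2 (hμ h)) (mul_self_nonneg _)
  have hsum : ∑ i, (μ k - μ i) * (c i * c i) ≤ 0 := by
    rw [hdot x, hdot (A *ᵥ x), Finset.mul_sum] at hx
    simp_rw [hAc] at hx
    rw [← sub_nonpos, ← Finset.sum_sub_distrib] at hx
    refine le_trans (le_of_eq ?_) hx
    exact Finset.sum_congr rfl fun i _ => by ring
  have hzero := (Finset.sum_eq_zero_iff_of_nonneg hnonneg).1
    (le_antisymm hsum (Finset.sum_nonneg hnonneg))
  rw [hexp (A *ᵥ x)]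
  conv_rhs => rw [hexp x, Finset.smul_sum]
  refine Finset.sum_congr rfl fun i hi => ?_
  rw [hAc, smul_smul]
  congr 1
  rcases mul_eq_zero.1 (hzero i hi) with h | h
  · rw [sub_eq_zero.1 h]
  · have : c i = 0 := mul_self_eq_zero.1 h
    rw [this, show (b i).ofLp ⬝ᵥ x = 0 from this]
    simp

end Spectral

section Path

variable {P : ℕ} {w lam : ℝ}

theorem pathA_isHermitian (n : ℕ) (w : ℝ) : (pathA n w).IsHermitian := by
  ext i j
  simp only [pathA, conjTranspose_apply, of_apply, star_trivial, Fin.ext_iff]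
  split_ifs <;> first | rfl | omega

theorem pathA_rev_rev (n : ℕ) (w : ℝ) (i j : Fin n) :
    pathA n w i.rev j.rev = pathA n w i j := by
  simp only [pathA, of_apply, Fin.ext_iff, Fin.val_rev]
  split_ifs <;> first | rfl | omega

theorem pathA_mulVec_zero (v : Fin (P + 2) → ℝ) :
    (pathA (P + 2) w *ᵥ v) 0 = w * v 0 + v 1 := by
  have h : ∀ j, pathA (P + 2) w 0 j * v j =
      (if j = 0 then w * v j else 0) + (if j = 1 then v j else 0) := by
    intro j
    simp only [pathA, of_apply, Fin.ext_iff, Fin.val_zero, Fin.val_one,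
      true_or, and_true, or_false, Nat.add_eq_zero_iff, one_ne_zero, and_false]
    split_ifs <;> first | omega | simp
  simp [mulVec, dotProduct, h, Finset.sum_add_distrib]

theorem pathA_mulVec_succ (v : Fin (P + 2) → ℝ) (i : ℕ) (hi : i < P) :
    (pathA (P + 2) w *ᵥ v) ⟨i + 1, by omega⟩ = v ⟨i, by omega⟩ + v ⟨i + 2, by omega⟩ := by
  have h : ∀ j, pathA (P + 2) w ⟨i + 1, by omega⟩ j * v j =
      (if j = ⟨i, by omega⟩ then v j else 0) + (if j = ⟨i + 2, by omega⟩ then v j else 0) := by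
    intro j
    simp only [pathA, of_apply, Fin.ext_iff, Nat.add_eq_zero_iff, one_ne_zero, and_false, false_or]
    split_ifs <;> first | omega | simp
  simp [mulVec, dotProduct, h, Finset.sum_add_distrib]

theorem eq_zero_of_head_eq_zero {v : Fin (P + 2) → ℝ}
    (hv : pathA (P + 2) w *ᵥ v = lam • v) (h0 : v 0 = 0) : v = 0 := by
  have h : ∀ i : ℕ, (∀ hi : i < P + 2, v ⟨i, hi⟩ = 0) ∧
      (∀ hi : i + 1 < P + 2, v ⟨i + 1, hi⟩ = 0) := by
    intro i
    induction i with
    | zero =>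
      have := congrFun hv 0
      rw [pathA_mulVec_zero] at this
      simp only [Pi.smul_apply, h0, smul_zero, mul_zero, zero_add] at this
      exact ⟨fun _ => h0, fun _ => this⟩
    | succ i ih =>
      refine ⟨ih.2, fun hi => ?_⟩
      have := congrFun hv ⟨i + 1, by omega⟩
      rw [pathA_mulVec_succ v i (by omega)] at this
      simpa [ih.1 (by omega), ih.2 (by omega)] using this
  ext i
  exact (h i).1 i.2

theorem head_mul_eq_head_mul {u v : Fin (P + 2) → ℝ}
    (hu : pathA (P + 2) w *ᵥ u = lam • u) (hv : pathA (P + 2) w *ᵥ v = lam • v)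
    (i : Fin (P + 2)) : u 0 * v i = v 0 * u i := by
  have h : pathA (P + 2) w *ᵥ (u 0 • v - v 0 • u) = lam • (u 0 • v - v 0 • u) := by
    rw [mulVec_sub, mulVec_smul, mulVec_smul, hu, hv, smul_sub, smul_comm lam, smul_comm lam]
  have := congrFun (eq_zero_of_head_eq_zero h (by simp [mul_comm])) i
  simpa [sub_eq_zero] using this

theorem pathA_eigenspace_simple (lam : ℝ) (u v : Fin (P + 2) → ℝ)
    (hu : pathA (P + 2) w *ᵥ u = lam • u) (hv : pathA (P + 2) w *ᵥ v = lam • v)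
    (huv : u ⬝ᵥ v = 0) : u = 0 ∨ v = 0 := by
  have h : u 0 • v = v 0 • u := by
    ext i
    simpa using head_mul_eq_head_mul hu hv i
  have h1 := congrArg (u ⬝ᵥ ·) h
  simp only [dotProduct_smul, huv, smul_eq_mul, mul_zero] at h1
  rcases mul_eq_zero.1 h1.symm with h2 | h2
  · exact Or.inr (eq_zero_of_head_eq_zero hv h2)
  · exact Or.inl (dotProduct_self_eq_zero.1 h2)

theorem exists_parity {u : Fin (P + 2) → ℝ}
    (hu : pathA (P + 2) w *ᵥ u = lam • u) (h0 : u ≠ 0) :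
    ∃ ε : ℝ, (ε = 1 ∨ ε = -1) ∧ ∀ i : Fin (P + 2), u i.rev = ε * u i := by
  have hu0 : u 0 ≠ 0 := fun h => h0 (eq_zero_of_head_eq_zero hu h)
  have hrev : pathA (P + 2) w *ᵥ (fun i => u i.rev) = lam • fun i => u i.rev := by
    ext i
    have h := congrFun hu i.rev
    simp only [mulVec, dotProduct, Pi.smul_apply] at h ⊢
    rw [← h, ← Equiv.sum_comp Fin.revPerm]
    refine Finset.sum_congr rfl fun j _ => ?_
    rw [← pathA_rev_rev]
    simp
  have key := head_mul_eq_head_mul hu hrev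
  have hsq := key (Fin.rev 0)
  rw [Fin.rev_rev] at hsq
  rcases mul_self_eq_mul_self_iff.1 hsq with h | h
  · refine ⟨1, Or.inl rfl, fun i => mul_left_cancel₀ hu0 ?_⟩
    linear_combination key i - h * u i
  · refine ⟨-1, Or.inr rfl, fun i => mul_left_cancel₀ hu0 ?_⟩
    linear_combination key i + h * u i

/-- Reverse the sign of the second half of a vector. -/
def flipSecondHalf (x : Fin (P + 2) → ℝ) : Fin (P + 2) → ℝ :=
  fun i => if 2 * i.val ≤ P + 1 then x i else -x i

theorem flipSecondHalf_zero (x : Fin (P + 2) → ℝ) : flipSecondHalf x 0 = x 0 := by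
  simp [flipSecondHalf]

theorem flipSecondHalf_rev_zero (x : Fin (P + 2) → ℝ) :
    flipSecondHalf x (Fin.rev 0) = -x (Fin.rev 0) := by
  simp [flipSecondHalf]

theorem flipSecondHalf_dotProduct_self (x : Fin (P + 2) → ℝ) :
    flipSecondHalf x ⬝ᵥ flipSecondHalf x = x ⬝ᵥ x := by
  refine Finset.sum_congr rfl fun i _ => ?_
  simp only [flipSecondHalf]
  split_ifs <;> ring

theorem dotProduct_mulVec_le_flipSecondHalf (x : Fin (P + 2) → ℝ)
    (hx : x ⟨(P + 1) / 2, by omega⟩ * x ⟨(P + 1) / 2 + 1, by omega⟩ ≤ 0) :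
    x ⬝ᵥ pathA (P + 2) w *ᵥ x ≤
      flipSecondHalf x ⬝ᵥ pathA (P + 2) w *ᵥ flipSecondHalf x := by
  simp only [dotProduct, mulVec, Finset.mul_sum]
  refine Finset.sum_le_sum fun i _ => Finset.sum_le_sum fun j _ => ?_
  simp only [flipSecondHalf]
  have hcross : ∀ i j : Fin (P + 2), 2 * i.val ≤ P + 1 → ¬ 2 * j.val ≤ P + 1 →
      x i * x j * pathA (P + 2) w i j ≤ 0 := by
    intro i j hi hj
    by_cases hij : i.val + 1 = j.val
    · have h1 : i = ⟨(P + 1) / 2, by omega⟩ := Fin.ext (by simp only; omega)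
      have h2 : j = ⟨(P + 1) / 2 + 1, by omega⟩ := Fin.ext (by simp only; omega)
      have h3 : pathA (P + 2) w i j = 1 := by
        simp only [pathA, of_apply, Fin.ext_iff]
        rw [if_neg (by omega), if_pos (by omega)]
      rw [h3, h1, h2, mul_one]
      exact hx
    · have h3 : pathA (P + 2) w i j = 0 := by
        simp only [pathA, of_apply, Fin.ext_iff]
        rw [if_neg (by omega), if_neg (by omega)]
      simp [h3]
  split_ifs with hi hj hj
  · exact le_rfl
  · linarith [hcross i j hi hj]
  · have := hcross j i hj hi
    rw [show pathA (P + 2) w j i = pathA (P + 2) w i j by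
      simpa using (pathA_isHermitian (P + 2) w).apply i j] at this
    linarith
  · linarith

variable {μ : Fin (P + 2) → ℝ}

theorem top_eigenvector_symm (hμ : IsEigList (P + 2) w μ) {u : Fin (P + 2) → ℝ}
    (hu : pathA (P + 2) w *ᵥ u = μ 0 • u) (h0 : u ≠ 0) (i : Fin (P + 2)) : u i.rev = u i := by
  obtain ⟨-, b, hb⟩ := exists_orthonormalBasis_of_charpoly_eq (pathA_isHermitian _ w) hμ.2
    pathA_eigenspace_simple
  obtain ⟨ε, rfl | rfl, hpar⟩ := exists_parity hu h0
  · simpa using hpar i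
  exfalso
  have hu0 : u 0 ≠ 0 := fun h => h0 (eq_zero_of_head_eq_zero hu h)
  have hmid : u ⟨(P + 1) / 2, by omega⟩ * u ⟨(P + 1) / 2 + 1, by omega⟩ ≤ 0 := by
    have h := hpar ⟨(P + 1) / 2, by omega⟩
    rcases Nat.even_or_odd' P with ⟨m, hm | hm⟩
    · have e : (⟨(P + 1) / 2, by omega⟩ : Fin (P + 2)).rev = ⟨(P + 1) / 2 + 1, by omega⟩ :=
        Fin.ext (by simp only [Fin.val_rev]; omega)
      rw [e] at h
      rw [h]
      nlinarith [sq_nonneg (u ⟨(P + 1) / 2, by omega⟩)]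
    · have e : (⟨(P + 1) / 2, by omega⟩ : Fin (P + 2)).rev = ⟨(P + 1) / 2, by omega⟩ :=
        Fin.ext (by simp only [Fin.val_rev]; omega)
      rw [e] at h
      have : u ⟨(P + 1) / 2, by omega⟩ = 0 := by linarith
      simp [this]
  have hle := dotProduct_mulVec_le_flipSecondHalf (w := w) u hmid
  have hflip := mulVec_eq_smul_of_le_dotProduct_mulVec (pathA_isHermitian _ w) hμ.1 b hb 0
    (flipSecondHalf u) (fun i hi => absurd hi (Fin.not_lt_zero i)) (by
      rw [flipSecondHalf_dotProduct_self]
      rwa [hu, dotProduct_smul, smul_eq_mul] at hle)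
  have h1 := head_mul_eq_head_mul hu hflip (Fin.rev 0)
  rw [flipSecondHalf_zero, flipSecondHalf_rev_zero, hpar] at h1
  exact hu0 (mul_self_eq_zero.1 (by linarith))

theorem second_eigenvector_antisymm (hμ : IsEigList (P + 2) w μ) {u : Fin (P + 2) → ℝ}
    (hu : pathA (P + 2) w *ᵥ u = μ 1 • u) (h0 : u ≠ 0) (i : Fin (P + 2)) :
    u i.rev = -u i := by
  have hA := pathA_isHermitian (P + 2) w
  obtain ⟨hinj, b, hb⟩ := exists_orthonormalBasis_of_charpoly_eq hA hμ.2
    pathA_eigenspace_simple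
  obtain ⟨ε, rfl | rfl, hpar⟩ := exists_parity hu h0
  swap
  · simpa using hpar i
  exfalso
  simp only [one_mul] at hpar
  set t : Fin (P + 2) → ℝ := (b 0).ofLp with ht
  have ht_eig : pathA (P + 2) w *ᵥ t = μ 0 • t := hb 0
  have ht0 : t ≠ 0 := by
    intro h
    exact b.orthonormal.ne_zero 0 (by ext k; simpa using congrFun h k)
  have hu0 : u 0 ≠ 0 := fun h => h0 (eq_zero_of_head_eq_zero hu h)
  have htsym := top_eigenvector_symm hμ ht_eig ht0
  have htu : t ⬝ᵥ u = 0 := by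
    have h1 : t ⬝ᵥ pathA (P + 2) w *ᵥ u = μ 0 * (t ⬝ᵥ u) := by
      have hsymm : (pathA (P + 2) w)ᵀ = pathA (P + 2) w := by
        simpa [Matrix.IsHermitian] using hA
      rw [dotProduct_mulVec, ← mulVec_transpose, hsymm, ht_eig, smul_dotProduct, smul_eq_mul]
    rw [hu, dotProduct_smul, smul_eq_mul] at h1
    have hne : μ 1 - μ 0 ≠ 0 := sub_ne_zero.2 fun h => by simpa using hinj h
    exact (mul_eq_zero.1 (show (μ 1 - μ 0) * (t ⬝ᵥ u) = 0 by linarith)).resolve_left hne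
  have htt : 0 < t ⬝ᵥ t := by
    simpa using dotProduct_star_self_pos_iff.2 ht0
  have huu : 0 < u ⬝ᵥ u := by
    simpa using dotProduct_star_self_pos_iff.2 h0
  set m : Fin (P + 2) := ⟨(P + 1) / 2, by omega⟩ with hm
  obtain ⟨α, β, hαβ, hmid⟩ : ∃ α β : ℝ, (α ≠ 0 ∨ β ≠ 0) ∧ α * t m + β * u m = 0 := by
    by_cases h : u m = 0
    · exact ⟨0, 1, by simp, by simp [h]⟩
    · exact ⟨u m, -t m, Or.inl h, by ring⟩
  set z : Fin (P + 2) → ℝ := α • t + β • u with hz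
  have hzm : z m = 0 := by simpa [hz] using hmid
  have hzrev : ∀ i : Fin (P + 2), z i.rev = z i := by
    intro i
    simp [hz, hpar, htsym]
  have hzz : z ⬝ᵥ z = α ^ 2 * (t ⬝ᵥ t) + β ^ 2 * (u ⬝ᵥ u) := by
    simp only [hz, add_dotProduct, dotProduct_add, smul_dotProduct, dotProduct_smul, smul_eq_mul,
      dotProduct_comm u t, htu]
    ring
  have hzpos : 0 < z ⬝ᵥ z := by
    rw [hzz]
    rcases hαβ with h | h <;> positivity
  have hzA : μ 1 * (z ⬝ᵥ z) ≤ z ⬝ᵥ pathA (P + 2) w *ᵥ z := by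
    have h1 : z ⬝ᵥ pathA (P + 2) w *ᵥ z =
        μ 0 * (α ^ 2 * (t ⬝ᵥ t)) + μ 1 * (β ^ 2 * (u ⬝ᵥ u)) := by
      simp only [hz, mulVec_add, mulVec_smul, ht_eig, hu, add_dotProduct, dotProduct_add,
        smul_dotProduct, dotProduct_smul, smul_eq_mul, dotProduct_comm u t, htu]
      ring
    have h2 : μ 1 ≤ μ 0 := hμ.1 (Fin.zero_le 1)
    rw [h1, hzz, mul_add]
    gcongr
  have hyrev : ∀ i : Fin (P + 2), flipSecondHalf z i.rev = -flipSecondHalf z i := by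
    intro i
    by_cases hi : i = m
    · have : flipSecondHalf z i = 0 := by simp [flipSecondHalf, hi, hzm]
      rw [this]
      simp [flipSecondHalf, hzrev, hi, hzm]
    · have hi' : i.val ≠ (P + 1) / 2 := fun h => hi (Fin.ext h)
      simp only [flipSecondHalf, Fin.val_rev, hzrev]
      split_ifs <;> first | omega | simp
  have hty : t ⬝ᵥ flipSecondHalf z = 0 := by
    have h : t ⬝ᵥ flipSecondHalf z = -(t ⬝ᵥ flipSecondHalf z) := by
      conv_lhs => rw [dotProduct, ← Equiv.sum_comp Fin.revPerm]
      simp [dotProduct, htsym, hyrev]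
    linarith
  have hy := mulVec_eq_smul_of_le_dotProduct_mulVec hA hμ.1 b hb 1 (flipSecondHalf z)
    (fun i hi => by
      have : i = 0 := Fin.ext (by simpa [Fin.lt_def] using hi)
      rw [this]
      exact hty) (by
      rw [flipSecondHalf_dotProduct_self]
      exact hzA.trans (dotProduct_mulVec_le_flipSecondHalf z (by rw [← hm, hzm, zero_mul])))
  have h1 := head_mul_eq_head_mul hu hy (Fin.rev 0)
  rw [hyrev, hpar] at h1
  have hy0 : flipSecondHalf z 0 = 0 :=
    (mul_eq_zero.1 (show u 0 * flipSecondHalf z 0 = 0 by linarith)).resolve_left hu0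
  rw [← flipSecondHalf_dotProduct_self, eq_zero_of_head_eq_zero hy hy0] at hzpos
  simp at hzpos

end Path

theorem sum_filter_odd_Icc (N : ℕ) (f : ℕ → ℝ) :
    ∑ k ∈ Finset.Icc 1 N with (-1 : ℝ) ^ k = -1, f k =
      ∑ ℓ ∈ Finset.Icc 1 ((N + 1) / 2), f (2 * ℓ - 1) := by
  refine (Finset.sum_nbij' (fun ℓ => 2 * ℓ - 1) (fun k => (k + 1) / 2) ?_ ?_ ?_ ?_ ?_).symm
  · intro ℓ hℓ
    simp only [Finset.mem_Icc, Finset.mem_filter] at hℓ ⊢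
    exact ⟨by omega, Odd.neg_one_pow ⟨ℓ - 1, by omega⟩⟩
  · intro k hk
    simp only [Finset.mem_Icc, Finset.mem_filter] at hk ⊢
    omega
  · intro ℓ hℓ
    simp only [Finset.mem_Icc] at hℓ
    omega
  · intro k hk
    simp only [Finset.mem_Icc, Finset.mem_filter, neg_one_pow_eq_neg_one_iff_odd
      (show (-1 : ℝ) ≠ 1 by norm_num)] at hk
    obtain ⟨m, hm⟩ := hk.2
    omega
  · exact fun _ _ => rfl

theorem sum_filter_even_Icc (N : ℕ) (f : ℕ → ℝ) :
    ∑ k ∈ Finset.Icc 1 N with (-1 : ℝ) ^ k = 1, f k =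
      ∑ ℓ ∈ Finset.Icc 1 (N / 2), f (2 * ℓ) := by
  refine (Finset.sum_nbij' (fun ℓ => 2 * ℓ) (fun k => k / 2) ?_ ?_ ?_ ?_ ?_).symm
  · intro ℓ hℓ
    simp only [Finset.mem_Icc, Finset.mem_filter] at hℓ ⊢
    exact ⟨by omega, Even.neg_one_pow ⟨ℓ, by omega⟩⟩
  · intro k hk
    simp only [Finset.mem_Icc, Finset.mem_filter, neg_one_pow_eq_one_iff_even
      (show (-1 : ℝ) ≠ 1 by norm_num)] at hk ⊢
    obtain ⟨m, hm⟩ := hk.2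
    omega
  · intro ℓ hℓ
    simp
  · intro k hk
    simp only [Finset.mem_Icc, Finset.mem_filter, neg_one_pow_eq_one_iff_even
      (show (-1 : ℝ) ≠ 1 by norm_num)] at hk
    obtain ⟨m, hm⟩ := hk.2
    omega
  · exact fun _ _ => rfl

theorem sq_head_eq_inv {P : ℕ} {w lam ε : ℝ} (hε : ε = 1 ∨ ε = -1) {v : Fin (P + 2) → ℝ}
    (hv : pathA (P + 2) w *ᵥ v = lam • v) (hunit : ∑ i, v i ^ 2 = 1)
    (hpar : ∀ i : Fin (P + 2), v i.rev = ε * v i) :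
    v 0 ^ 2 = (2 + 8 / ((P + 1 : ℕ) : ℝ) * ∑ k ∈ Finset.Icc 1 (P + 1) with (-1) ^ k = -ε,
      sin (k * π / (P + 1 : ℕ)) ^ 2 / (lam - 2 * cos (k * π / (P + 1 : ℕ))) ^ 2)⁻¹ := by
  have h0 : v 0 ≠ 0 := fun h => by simp [eq_zero_of_head_eq_zero hv h] at hunit
  set V : ℕ → ℝ := fun i => if h : i < P + 2 then v ⟨i, h⟩ else 0 with hV
  have hVv : ∀ i (h : i < P + 2), V i = v ⟨i, h⟩ := fun i h => dif_pos h
  have hV0 : V 0 = v 0 := hVv 0 (by omega)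
  rw [← hV0]
  refine eq_inv_of_mul_eq_one_left (sq_head_mul_eq_one P V lam ε hε ?_ ?_ (hV0 ▸ h0) ?_)
  · intro i hi
    rw [hVv i (by omega), hVv (i + 1) (by omega), hVv (i + 2) (by omega),
      ← pathA_mulVec_succ (w := w) v i hi, hv]
    simp
  · intro i hi
    rw [hVv i (by omega), hVv (P + 1 - i) (by omega), ← hpar]
    congr 1
    exact Fin.ext (by simp only [Fin.val_rev]; omega)
  · rw [← Fin.sum_univ_eq_sum_range (fun i => V i ^ 2), ← hunit]
    exact Finset.sum_congr rfl fun i _ => by rw [hVv i i.2]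

/-- For `n ≥ 3` and `w > 1`, explicit formulas for the squared first entries of unit
eigenvectors for the two largest eigenvalues.  Here `⌈(n−1)/2⌉ = n/2` and
`⌈(n−2)/2⌉ = (n−1)/2` in natural-number division. -/
theorem v11_v12_formulas (n : ℕ) (hn : 3 ≤ n) (w : ℝ) (hw : 1 < w)
    (μ : Fin n → ℝ) (hμ : IsEigList n w μ)
    (v1 v2 : Fin n → ℝ)
    (hv1unit : ∑ i, v1 i ^ 2 = 1)
    (hv1 : (pathA n w).mulVec v1 = μ ⟨0, by omega⟩ • v1)
    (hv2unit : ∑ i, v2 i ^ 2 = 1)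
    (hv2 : (pathA n w).mulVec v2 = μ ⟨1, by omega⟩ • v2) :
    v1 ⟨0, by omega⟩ ^ 2 =
      (2 + 8 / ((n : ℝ) - 1) * ∑ ℓ ∈ Finset.Icc 1 (n / 2),
        Real.sin ((2 * (ℓ : ℝ) - 1) * π / ((n : ℝ) - 1)) ^ 2 /
          (μ ⟨0, by omega⟩ - 2 * Real.cos ((2 * (ℓ : ℝ) - 1) * π / ((n : ℝ) - 1))) ^ 2)⁻¹ ∧
    v2 ⟨0, by omega⟩ ^ 2 =
      (2 + 8 / ((n : ℝ) - 1) * ∑ ℓ ∈ Finset.Icc 1 ((n - 1) / 2),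
        Real.sin (2 * (ℓ : ℝ) * π / ((n : ℝ) - 1)) ^ 2 /
          (μ ⟨1, by omega⟩ - 2 * Real.cos (2 * (ℓ : ℝ) * π / ((n : ℝ) - 1))) ^ 2)⁻¹ := by
  obtain ⟨P, rfl⟩ : ∃ P, n = P + 2 := ⟨n - 2, by omega⟩
  have hcast : ((P + 2 : ℕ) : ℝ) - 1 = (P + 1 : ℕ) := by push_cast; ring
  have h1 : v1 ≠ 0 := fun h => by simp [h] at hv1unit
  have h2 : v2 ≠ 0 := fun h => by simp [h] at hv2unit
  rw [hcast]
  constructor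
  · refine (sq_head_eq_inv (Or.inl rfl) hv1 hv1unit fun i => ?_).trans ?_
    · rw [one_mul]
      exact top_eigenvector_symm hμ hv1 h1 i
    · rw [sum_filter_odd_Icc]
      congr 3
      refine Finset.sum_congr rfl fun ℓ hℓ => ?_
      have hℓ' := (Finset.mem_Icc.1 hℓ).1
      have e : ((2 * ℓ - 1 : ℕ) : ℝ) = 2 * ℓ - 1 := by
        push_cast [show 1 ≤ 2 * ℓ by omega]
        ring
      rw [e]
  · refine (sq_head_eq_inv (Or.inr rfl) hv2 hv2unit fun i => ?_).trans ?_
    · rw [neg_one_mul]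
      exact second_eigenvector_antisymm hμ hv2 h2 i
    · rw [neg_neg, sum_filter_even_Icc]
      congr 3
      refine Finset.sum_congr rfl fun ℓ _ => ?_
      rw [Nat.cast_mul, Nat.cast_ofNat]
end

section
/- Let (x_n)_{n≥3} be a sequence of positive real numbers converging to a real number x > 2. Then, as n → ∞: (a) 2 + (8/(n−1)) · Σ_{ℓ=1}^{⌈(n−1)/2⌉} sin²((2ℓ−1)π/(n−1)) / (x_n − 2cos((2ℓ−1)π/(n−1)))² converges to (x + √(x²−4))/√(x²−4); and (b) 2 + (8/(n−1)) · Σ_{ℓ=1}^{⌈(n−2)/2⌉} sin²(2ℓπ/(n−1)) / (x_n − 2cos(2ℓπ/(n−1)))² converges to (x + √(x²−4))/√(x²−4). -/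
open Real Filter

/-- The integrand `sin² θ / (x - 2 cos θ)²`. -/
noncomputable def sinSqDivSq (x θ : ℝ) : ℝ := sin θ ^ 2 / (x - 2 * cos θ) ^ 2

/-- An antiderivative of `sinSqDivSq x`, smooth on the whole real line when `2 < x`. -/
noncomputable def sinSqDivSqPrimitive (x θ : ℝ) : ℝ :=
  -(sin θ / (2 * (x - 2 * cos θ))) - θ / 4 +
    x / 4 * (θ / √(x ^ 2 - 4) + 2 / √(x ^ 2 - 4) *
      arctan ((x - √(x ^ 2 - 4)) / 2 * sin θ / (1 - (x - √(x ^ 2 - 4)) / 2 * cos θ)))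

theorem sub_two_mul_cos_pos {x : ℝ} (hx : 2 < x) (θ : ℝ) : 0 < x - 2 * cos θ := by
  linarith [cos_le_one θ]

theorem sqrt_sq_sub_four_pos {x : ℝ} (hx : 2 < x) : 0 < √(x ^ 2 - 4) :=
  sqrt_pos.2 (by nlinarith)

theorem sq_sqrt_sq_sub_four {x : ℝ} (hx : 2 < x) : √(x ^ 2 - 4) ^ 2 = x ^ 2 - 4 :=
  sq_sqrt (by nlinarith)

theorem one_sub_mul_cos_pos {x : ℝ} (hx : 2 < x) (θ : ℝ) :
    0 < 1 - (x - √(x ^ 2 - 4)) / 2 * cos θ := by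
  have hs := sqrt_sq_sub_four_pos hx
  have hs2 := sq_sqrt_sq_sub_four hx
  have h0 : 0 < (x - √(x ^ 2 - 4)) / 2 := by nlinarith
  have h1 : (x - √(x ^ 2 - 4)) / 2 < 1 := by nlinarith
  nlinarith [cos_le_one θ]

theorem hasDerivAt_sinSqDivSqPrimitive {x : ℝ} (hx : 2 < x) (θ : ℝ) :
    HasDerivAt (sinSqDivSqPrimitive x) (sinSqDivSq x θ) θ := by
  have hs := sqrt_sq_sub_four_pos hx
  have hs2 := sq_sqrt_sq_sub_four hx
  have hd := sub_two_mul_cos_pos hx θ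
  have hv := one_sub_mul_cos_pos hx θ
  unfold sinSqDivSqPrimitive sinSqDivSq
  set s := √(x ^ 2 - 4)
  obtain ⟨r, hr⟩ : ∃ r, r = (x - s) / 2 := ⟨_, rfl⟩
  rw [← hr] at hv ⊢
  have hr2 : r ^ 2 - x * r + 1 = 0 := by rw [hr]; linear_combination hs2 / 4
  have hsr : s = x - 2 * r := by rw [hr]; ring
  have hr0 : r ≠ 0 := by rintro rfl; norm_num at hr2
  have hsc := sin_sq_add_cos_sq θ
  have hq : HasDerivAt (fun t => r * sin t / (1 - r * cos t))
      ((r * cos θ * (1 - r * cos θ) - r * sin θ * (r * sin θ)) / (1 - r * cos θ) ^ 2) θ := by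
    refine ((hasDerivAt_sin θ).const_mul r).div
      (((hasDerivAt_cos θ).const_mul r).const_sub 1 |>.congr_deriv ?_) hv.ne'
    ring
  have hat : HasDerivAt (fun t => arctan (r * sin t / (1 - r * cos t)))
      ((cos θ - r) / (x - 2 * cos θ)) θ := by
    refine hq.arctan.congr_deriv ?_
    have h1 : 1 + (r * sin θ / (1 - r * cos θ)) ^ 2 =
        r * (x - 2 * cos θ) / (1 - r * cos θ) ^ 2 := by
      field_simp
      linear_combination r ^ 2 * hsc + hr2
    rw [h1]
    field_simp
    linear_combination -r * hsc
  have hfrac : HasDerivAt (fun t => sin t / (2 * (x - 2 * cos t)))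
      ((cos θ * (2 * (x - 2 * cos θ)) - sin θ * (4 * sin θ)) / (2 * (x - 2 * cos θ)) ^ 2) θ := by
    refine (hasDerivAt_sin θ).div
      ((((hasDerivAt_cos θ).const_mul 2).const_sub x).const_mul 2 |>.congr_deriv ?_)
      (by positivity)
    ring
  refine ((hfrac.neg.sub ((hasDerivAt_id θ).div_const 4)).add
    ((((hasDerivAt_id θ).div_const s).add (hat.const_mul (2 / s))).const_mul (x / 4))).congr_deriv ?_
  have h2 : 1 / s + 2 / s * ((cos θ - r) / (x - 2 * cos θ)) = 1 / (x - 2 * cos θ) := by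
    field_simp
    rw [hsr]
    ring
  rw [h2]
  obtain ⟨D, hD⟩ : ∃ D, D = x - 2 * cos θ := ⟨_, rfl⟩
  rw [← hD] at hd ⊢
  field_simp
  rw [hD]
  ring

theorem sinSqDivSqPrimitive_zero (x : ℝ) : sinSqDivSqPrimitive x 0 = 0 := by
  simp [sinSqDivSqPrimitive]

theorem sinSqDivSqPrimitive_pi (x : ℝ) :
    sinSqDivSqPrimitive x π = π / 4 * (x / √(x ^ 2 - 4) - 1) := by
  simp only [sinSqDivSqPrimitive, sin_pi, mul_zero, zero_div, arctan_zero]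
  ring

theorem continuousAt_sinSqDivSqPrimitive {x : ℝ} (hx : 2 < x) (θ : ℝ) :
    ContinuousAt (fun p : ℝ × ℝ => sinSqDivSqPrimitive p.1 p.2) (x, θ) := by
  have hs := (sqrt_sq_sub_four_pos hx).ne'
  have hd := (sub_two_mul_cos_pos hx θ).ne'
  have hv := (one_sub_mul_cos_pos hx θ).ne'
  unfold sinSqDivSqPrimitive
  have hd' : 2 * (x - 2 * cos θ) ≠ 0 := by simpa using hd
  fun_prop (disch := assumption)

theorem abs_sinSqDivSq_sub_le {d M x : ℝ} (hd : 0 < d) (hx : 2 + d ≤ x) (hM : x ≤ M) (s t : ℝ) :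
    |sinSqDivSq x s - sinSqDivSq x t| ≤ 2 * (M + 2) / d ^ 3 * |s - t| := by
  have hder : ∀ θ ∈ Set.univ, HasDerivWithinAt (sinSqDivSq x)
      (2 * sin θ * (x * cos θ - 2) / (x - 2 * cos θ) ^ 3) Set.univ θ := by
    intro θ _
    have hp := sub_two_mul_cos_pos (by linarith : 2 < x) θ
    refine HasDerivAt.hasDerivWithinAt ?_
    unfold sinSqDivSq
    refine (((hasDerivAt_sin θ).pow 2).div
      ((((hasDerivAt_cos θ).const_mul 2).const_sub x).pow 2) (pow_ne_zero 2 hp.ne')).congr_deriv ?_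
    simp only [Nat.cast_ofNat, Nat.add_one_sub_one, pow_one, Pi.pow_apply]
    field_simp
    linear_combination (-2 * sin θ) * sin_sq_add_cos_sq θ
  have hbound : ∀ θ ∈ Set.univ, ‖2 * sin θ * (x * cos θ - 2) / (x - 2 * cos θ) ^ 3‖ ≤
      2 * (M + 2) / d ^ 3 := by
    intro θ _
    have hp : d ≤ x - 2 * cos θ := by linarith [cos_le_one θ]
    have hx0 : 0 < x := by linarith
    have h1 : |x * cos θ - 2| ≤ M + 2 := by
      rw [abs_le]
      constructor <;> nlinarith [cos_le_one θ, neg_one_le_cos θ]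
    rw [norm_div, norm_mul, norm_mul, norm_pow, Real.norm_eq_abs, Real.norm_eq_abs,
      Real.norm_eq_abs, Real.norm_eq_abs, abs_of_pos (hd.trans_le hp), abs_two]
    have h2 : 2 * |sin θ| * |x * cos θ - 2| ≤ 2 * (M + 2) := by
      nlinarith [abs_sin_le_one θ, abs_nonneg (sin θ), abs_nonneg (x * cos θ - 2)]
    have hM0 : 0 ≤ 2 * (M + 2) := by linarith
    gcongr
  exact convex_univ.norm_image_sub_le_of_norm_hasDerivWithin_le hder hbound
    (Set.mem_univ t) (Set.mem_univ s)

theorem abs_sub_sub_mul_le_of_lipschitz {f F : ℝ → ℝ} {L : ℝ} (hL : 0 ≤ L)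
    (hF : ∀ t, HasDerivAt F (f t) t) (hf : ∀ s t, |f s - f t| ≤ L * |s - t|)
    {a b c : ℝ} (hac : a ≤ c) (hcb : c ≤ b) :
    |F b - F a - (b - a) * f c| ≤ L * (b - a) ^ 2 := by
  have hder : ∀ t ∈ Set.Icc a b, HasDerivWithinAt (fun t => F t - t * f c) (f t - 1 * f c)
      (Set.Icc a b) t := fun t _ =>
    ((hF t).sub ((hasDerivAt_id t).mul_const (f c))).hasDerivWithinAt
  have hbound : ∀ t ∈ Set.Icc a b, ‖f t - 1 * f c‖ ≤ L * (b - a) := by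
    intro t ht
    rw [one_mul]
    refine (hf t c).trans (mul_le_mul_of_nonneg_left ?_ hL)
    rw [abs_le]
    constructor <;> linarith [ht.1, ht.2]
  have h := (convex_Icc a b).norm_image_sub_le_of_norm_hasDerivWithin_le hder hbound
    (Set.left_mem_Icc.2 (hac.trans hcb)) (Set.right_mem_Icc.2 (hac.trans hcb))
  rw [Real.norm_eq_abs, Real.norm_eq_abs, abs_of_nonneg (sub_nonneg.2 (hac.trans hcb))] at h
  calc _ = |F b - b * f c - (F a - a * f c)| := by ring_nf
    _ ≤ _ := h
    _ = _ := by ring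

theorem abs_sub_riemann_sum_le_of_lipschitz {f F : ℝ → ℝ} {L h : ℝ} (hL : 0 ≤ L)
    (hF : ∀ t, HasDerivAt F (f t) t) (hf : ∀ s t, |f s - f t| ≤ L * |s - t|) {c : ℕ → ℝ}
    (hc : ∀ l : ℕ, ((l : ℝ) - 1) * h ≤ c l ∧ c l ≤ l * h) (m : ℕ) :
    |F (m * h) - F 0 - h * ∑ l ∈ Finset.Icc 1 m, f (c l)| ≤ L * (m * h) * h := by
  induction m with
  | zero => simp
  | succ k ih =>
    rw [Finset.sum_Icc_succ_top (by omega)]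
    have hck := hc (k + 1)
    have hstep := abs_sub_sub_mul_le_of_lipschitz hL hF hf hck.1 hck.2
    push_cast at hstep ⊢
    rw [add_sub_cancel_right, show ((k : ℝ) + 1) * h - k * h = h by ring] at hstep
    calc _ = |(F (k * h) - F 0 - h * ∑ l ∈ Finset.Icc 1 k, f (c l)) +
            (F ((k + 1) * h) - F (k * h) - h * f (c (k + 1)))| := by ring_nf
      _ ≤ _ := abs_add_le _ _
      _ ≤ L * (k * h) * h + L * h ^ 2 := add_le_add ih hstep
      _ = _ := by ring

theorem tendsto_two_pi_div_sub_one :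
    Tendsto (fun n : ℕ => 2 * π / ((n : ℝ) - 1)) atTop (nhds 0) :=
  tendsto_const_nhds.div_atTop
    (tendsto_atTop_add_const_right atTop (-1) tendsto_natCast_atTop_atTop)

theorem tendsto_mul_two_pi_div_sub_one {m : ℕ → ℕ}
    (hm : ∀ n, 2 ≤ n → n ≤ 2 * m n + 2 ∧ 2 * m n ≤ n) :
    Tendsto (fun n : ℕ => m n * (2 * π / ((n : ℝ) - 1))) atTop (nhds π) := by
  have h0 := tendsto_two_pi_div_sub_one
  have hlo : Tendsto (fun n : ℕ => π - 2 * π / ((n : ℝ) - 1)) atTop (nhds π) := by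
    simpa using h0.const_sub π
  have hhi : Tendsto (fun n : ℕ => π + 2 * π / ((n : ℝ) - 1)) atTop (nhds π) := by
    simpa using h0.const_add π
  have hdist : ∀ n : ℕ, 2 ≤ n → |m n * (2 * π / ((n : ℝ) - 1)) - π| ≤ 2 * π / ((n : ℝ) - 1) := by
    intro n hn
    have hn' : (2 : ℝ) ≤ n := by exact_mod_cast hn
    have hpos : 0 < (n : ℝ) - 1 := by linarith
    have h1 : (n : ℝ) ≤ 2 * m n + 2 := by exact_mod_cast (hm n hn).1
    have h2 : 2 * (m n : ℝ) ≤ n := by exact_mod_cast (hm n hn).2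
    have heq : m n * (2 * π / ((n : ℝ) - 1)) - π =
        (2 * m n - (n - 1)) * (π / ((n : ℝ) - 1)) := by
      field_simp
    have hq : 0 < π / ((n : ℝ) - 1) := div_pos pi_pos hpos
    rw [heq, abs_mul, abs_of_pos hq, mul_div_assoc]
    refine mul_le_mul_of_nonneg_right ?_ hq.le
    rw [abs_le]
    constructor <;> linarith
  refine tendsto_of_tendsto_of_tendsto_of_le_of_le' hlo hhi ?_ ?_ <;>
  · filter_upwards [eventually_ge_atTop 2] with n hn
    linarith [abs_le.1 (hdist n hn)]

theorem tendsto_two_add_sum_sinSqDivSq {x : ℕ → ℝ} {X : ℝ} (hX : 2 < X)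
    (hlim : Tendsto x atTop (nhds X)) {m : ℕ → ℕ} {c : ℕ → ℕ → ℝ}
    (hm : ∀ n, 2 ≤ n → n ≤ 2 * m n + 2 ∧ 2 * m n ≤ n)
    (hc : ∀ n : ℕ, 2 ≤ n → ∀ l : ℕ, ((l : ℝ) - 1) * (2 * π / ((n : ℝ) - 1)) ≤ c n l ∧
      c n l ≤ l * (2 * π / ((n : ℝ) - 1))) :
    Tendsto (fun n : ℕ => 2 + 8 / ((n : ℝ) - 1) *
        ∑ l ∈ Finset.Icc 1 (m n), sinSqDivSq (x n) (c n l))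
      atTop (nhds ((X + √(X ^ 2 - 4)) / √(X ^ 2 - 4))) := by
  obtain ⟨d, hd, hdX⟩ : ∃ d, 0 < d ∧ 2 + d < X := ⟨(X - 2) / 2, by linarith, by linarith⟩
  have hmesh := tendsto_two_pi_div_sub_one
  have hend := tendsto_mul_two_pi_div_sub_one hm
  have hprim : Tendsto (fun n : ℕ => sinSqDivSqPrimitive (x n) (m n * (2 * π / ((n : ℝ) - 1))))
      atTop (nhds (sinSqDivSqPrimitive X π)) :=
    Tendsto.comp (f := fun n : ℕ => (x n, m n * (2 * π / ((n : ℝ) - 1))))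
      (continuousAt_sinSqDivSqPrimitive hX π) (hlim.prodMk_nhds hend)
  have herr : Tendsto (fun n : ℕ =>
      sinSqDivSqPrimitive (x n) (m n * (2 * π / ((n : ℝ) - 1))) -
        2 * π / ((n : ℝ) - 1) * ∑ l ∈ Finset.Icc 1 (m n), sinSqDivSq (x n) (c n l))
      atTop (nhds 0) := by
    refine squeeze_zero_norm' (a := fun n : ℕ => 2 * ((X + 1) + 2) / d ^ 3 *
      (m n * (2 * π / ((n : ℝ) - 1))) * (2 * π / ((n : ℝ) - 1))) ?_ ?_
    · filter_upwards [eventually_ge_atTop 2, hlim.eventually (eventually_gt_nhds hdX),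
        hlim.eventually (eventually_lt_nhds (lt_add_one X))] with n hn hlow hhigh
      have hL : 0 ≤ 2 * ((X + 1) + 2) / d ^ 3 := div_nonneg (by linarith) (by positivity)
      have h := abs_sub_riemann_sum_le_of_lipschitz hL
        (hasDerivAt_sinSqDivSqPrimitive (by linarith : 2 < x n))
        (abs_sinSqDivSq_sub_le hd hlow.le hhigh.le) (hc n hn) (m n)
      rwa [sinSqDivSqPrimitive_zero, sub_zero] at h
    · have h := (hend.const_mul (2 * ((X + 1) + 2) / d ^ 3)).mul hmesh
      rwa [mul_zero] at h
  have hs := (sqrt_sq_sub_four_pos hX).ne'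
  have hmain := ((hprim.sub herr).const_mul (4 / π)).const_add 2
  rw [sinSqDivSqPrimitive_pi] at hmain
  convert hmain using 1
  · ext n
    rw [sub_sub_cancel, ← mul_assoc]
    congr 2
    field_simp
    norm_num
  · congr 1
    field_simp
    ring

/-- If `xₙ → x > 2` with `xₙ > 0`, then both Riemann-sum-type expressions converge to
`(x + √(x²−4))/√(x²−4)`.  Here `⌈(n−1)/2⌉ = n/2` and `⌈(n−2)/2⌉ = (n−1)/2` in
natural-number division. -/
theorem limit_sums (x : ℕ → ℝ) (X : ℝ) (hX : 2 < X)
    (hpos : ∀ n : ℕ, 3 ≤ n → 0 < x n)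
    (hlim : Tendsto x atTop (nhds X)) :
    Tendsto (fun n : ℕ =>
        2 + 8 / ((n : ℝ) - 1) * ∑ ℓ ∈ Finset.Icc 1 (n / 2),
          Real.sin ((2 * (ℓ : ℝ) - 1) * π / ((n : ℝ) - 1)) ^ 2 /
            (x n - 2 * Real.cos ((2 * (ℓ : ℝ) - 1) * π / ((n : ℝ) - 1))) ^ 2)
      atTop (nhds ((X + Real.sqrt (X ^ 2 - 4)) / Real.sqrt (X ^ 2 - 4))) ∧
    Tendsto (fun n : ℕ =>
        2 + 8 / ((n : ℝ) - 1) * ∑ ℓ ∈ Finset.Icc 1 ((n - 1) / 2),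
          Real.sin (2 * (ℓ : ℝ) * π / ((n : ℝ) - 1)) ^ 2 /
            (x n - 2 * Real.cos (2 * (ℓ : ℝ) * π / ((n : ℝ) - 1))) ^ 2)
      atTop (nhds ((X + Real.sqrt (X ^ 2 - 4)) / Real.sqrt (X ^ 2 - 4))) := by
  constructor
  · refine tendsto_two_add_sum_sinSqDivSq hX hlim (fun n _ => by omega) fun n hn l => ?_
    have hn' : (2 : ℝ) ≤ n := by exact_mod_cast hn
    have hq : 0 < π / ((n : ℝ) - 1) := div_pos pi_pos (by linarith)
    constructor <;> simp only [mul_div_assoc] <;> nlinarith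
  · refine tendsto_two_add_sum_sinSqDivSq hX hlim (fun n _ => by omega) fun n hn l => ?_
    have hn' : (2 : ℝ) ≤ n := by exact_mod_cast hn
    have hq : 0 < π / ((n : ℝ) - 1) := div_pos pi_pos (by linarith)
    constructor <;> simp only [mul_div_assoc] <;> nlinarith
end

section
/- Fix an integer n ≥ 3 and a real w > 1. Then the squared first entries of unit eigenvectors of A(w) for its two largest eigenvalues converge as n → ∞: lim_{n→∞} v_{11}(n)² = (w² − 1)/(2w²) and lim_{n→∞} v_{12}(n)² = (w² − 1)/(2w²). -/
open Polynomial Real Filter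

/-- The eigenvalue equation for `pathA`, row by row. -/
theorem pathA_mulVec_eq_smul_iff (m : ℕ) (w θ : ℝ) (u : ℕ → ℝ) :
    (pathA (m + 2) w).mulVec (fun i => u i) = θ • (fun i : Fin (m + 2) => u i) ↔
      w * u 0 + u 1 = θ * u 0 ∧ (∀ k < m, u k + u (k + 2) = θ * u (k + 1)) ∧
        u m + w * u (m + 1) = θ * u (m + 1) := by
  have row : ∀ i : Fin (m + 2), (pathA (m + 2) w).mulVec (fun i => u i) i =
      (if i.val = 0 ∨ i.val = m + 1 then w * u i else 0) +
        (if i.val + 1 < m + 2 then u (i + 1) else 0) +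
        (if 0 < i.val then u (i - 1) else 0) := by
    intro i
    have hsum : (pathA (m + 2) w).mulVec (fun i => u i) i = ∑ j ∈ Finset.range (m + 2),
        ((if i.val = j then (if i.val = 0 ∨ i.val = m + 1 then w * u j else 0) else 0) +
        (if i.val + 1 = j then u j else 0) +
        (if i.val - 1 = j then (if 0 < i.val then u j else 0) else 0)) := by
      rw [← Fin.sum_univ_eq_sum_range, Matrix.mulVec, dotProduct]
      refine Finset.sum_congr rfl fun j _ => ?_
      simp only [pathA, Matrix.of_apply, Fin.ext_iff]
      grind
    rw [hsum, Finset.sum_add_distrib, Finset.sum_add_distrib, Finset.sum_ite_eq,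
      Finset.sum_ite_eq, Finset.sum_ite_eq]
    have := i.isLt
    simp only [Finset.mem_range]
    rw [if_pos this, if_pos (show i.val - 1 < m + 2 by omega)]
  constructor
  · intro h
    have h' := fun i => (row i).symm.trans (congrFun h i)
    refine ⟨?_, fun k hk => ?_, ?_⟩
    · have := h' ⟨0, by omega⟩
      simpa using this
    · have := h' ⟨k + 1, by omega⟩
      simp only [Pi.smul_apply, smul_eq_mul] at this
      rw [if_neg (by omega), if_pos (by omega), if_pos (by omega)] at this
      simp only [Nat.add_sub_cancel] at this
      linarith
    · have := h' ⟨m + 1, by omega⟩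
      simp only [Pi.smul_apply, smul_eq_mul] at this
      rw [if_pos (.inr trivial), if_neg (by omega), if_pos (by omega)] at this
      simp only [Nat.add_sub_cancel] at this
      linarith
  · rintro ⟨h0, hk, hm⟩
    ext i
    rw [row]
    obtain ⟨i, hi⟩ := i
    simp only [Pi.smul_apply, smul_eq_mul]
    rcases i with _ | i
    · simpa using h0
    · rcases Nat.lt_or_ge i m with him | him
      · rw [if_neg (by omega), if_pos (by omega), if_pos (by omega)]
        have := hk i him
        simp only [Nat.add_sub_cancel]
        linarith
      · obtain rfl : i = m := by omega
        rw [if_pos (by omega), if_neg (by omega), if_pos (by omega)]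
        simp only [Nat.add_sub_cancel]
        linarith

/-- Solutions of the three-term recurrence are combinations of two geometric sequences. -/
theorem exists_geometric_of_recurrence {m : ℕ} {r : ℝ} (hr0 : 0 < r) (hr1 : r < 1) {u : ℕ → ℝ}
    (hu : ∀ k < m, u k + u (k + 2) = (r + r⁻¹) * u (k + 1)) :
    ∃ a b : ℝ, ∀ k ≤ m + 1, u k = a * r ^ k + b * r ^ (m + 1 - k) := by
  have hd : 1 - r ^ 2 ≠ 0 := by nlinarith
  obtain ⟨a, c, h0, h1⟩ : ∃ a c : ℝ, u 0 = a + c ∧ u 1 = a * r + c * r⁻¹ := by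
    refine ⟨(u 0 - r * u 1) / (1 - r ^ 2), (r * u 1 - r ^ 2 * u 0) / (1 - r ^ 2), ?_, ?_⟩
    · field_simp
      ring
    · field_simp
      ring
  have key : ∀ k, k ≤ m → u k = a * r ^ k + c * r⁻¹ ^ k ∧
      u (k + 1) = a * r ^ (k + 1) + c * r⁻¹ ^ (k + 1) := by
    intro k
    induction k with
    | zero => intro _; simpa using ⟨h0, h1⟩
    | succ k ih =>
      intro hk
      obtain ⟨e0, e1⟩ := ih (by omega)
      refine ⟨e1, ?_⟩
      have e2 := hu k (by omega)
      rw [e0, e1] at e2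
      have hri : r * r⁻¹ = 1 := mul_inv_cancel₀ hr0.ne'
      rw [show k + 1 + 1 = k + 2 from rfl]
      linear_combination e2 + (a * r ^ k + c * r⁻¹ ^ k) * hri
  have key' : ∀ k ≤ m + 1, u k = a * r ^ k + c * r⁻¹ ^ k := by
    rintro (_ | k) hk
    · exact (key 0 (by omega)).1
    · exact (key k (by omega)).2
  refine ⟨a, c * r⁻¹ ^ (m + 1), fun k hk => ?_⟩
  rw [key' k hk]
  obtain ⟨j, hj⟩ := Nat.exists_eq_add_of_le hk
  rw [show m + 1 - k = j by omega, hj, pow_add, mul_assoc c, mul_assoc, ← mul_pow,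
    inv_mul_cancel₀ hr0.ne', one_pow, mul_one]

theorem add_inv_lt_add_inv {r s : ℝ} (hr : 0 < r) (hrs : r < s) (hs : s < 1) :
    s + s⁻¹ < r + r⁻¹ := by
  have hs0 : 0 < s := hr.trans hrs
  have : r + r⁻¹ - (s + s⁻¹) = (s - r) * (1 - r * s) / (r * s) := by
    field_simp
    ring
  have : 0 < (s - r) * (1 - r * s) / (r * s) := by
    have : 0 < 1 - r * s := by nlinarith
    have : 0 < s - r := by linarith
    positivity
  linarith

theorem exists_add_inv_eq {ρ θ : ℝ} (hρ0 : 0 < ρ) (hθ : ρ + ρ⁻¹ ≤ θ) :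
    ∃ r, 0 < r ∧ r ≤ ρ ∧ r + r⁻¹ = θ := by
  have hi : 0 < ρ⁻¹ := inv_pos.mpr hρ0
  have hθ0 : 0 < θ := by linarith
  have hlow : θ⁻¹ ≤ ρ := by
    rw [inv_le_comm₀ hθ0 hρ0]
    linarith
  have hcont : ContinuousOn (fun r : ℝ => r + r⁻¹) (Set.Icc θ⁻¹ ρ) := by
    refine continuousOn_id.add (continuousOn_inv₀.mono fun x hx => ?_)
    exact ((inv_pos.mpr hθ0).trans_le hx.1).ne'
  obtain ⟨r, hr, hrθ⟩ := intermediate_value_Icc' hlow hcont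
    ⟨hθ, by simp [hθ0.le]⟩
  exact ⟨r, (inv_pos.mpr hθ0).trans_le hr.1, hr.2, hrθ⟩

/-- A root of the boundary equation yields an eigenvalue of `pathA`. -/
theorem exists_eigList_eq {m : ℕ} {w r ε : ℝ} (hr0 : 0 < r) (hr1 : r < 1)
    (hε : ε = 1 ∨ ε = -1) (hroot : r⁻¹ - w = ε * (r ^ (m + 1) * (w - r)))
    {μ : Fin (m + 2) → ℝ} (hμ : IsEigList (m + 2) w μ) : ∃ i, μ i = r + r⁻¹ := by
  have hri : r * r⁻¹ = 1 := mul_inv_cancel₀ hr0.ne'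
  have hε2 : ε * ε = 1 := by rcases hε with rfl | rfl <;> norm_num
  let u : ℕ → ℝ := fun k => r ^ k + ε * r ^ (m + 1 - k)
  have hAu : (pathA (m + 2) w).mulVec (fun i => u i) =
      (r + r⁻¹) • (fun i : Fin (m + 2) => u i) := by
    rw [pathA_mulVec_eq_smul_iff]
    refine ⟨?_, fun k hk => ?_, ?_⟩
    · simp only [u, Nat.sub_zero, Nat.add_sub_cancel]
      rw [pow_succ] at hroot ⊢
      linear_combination -hroot - ε * r ^ m * hri
    · obtain ⟨j, rfl⟩ := Nat.exists_eq_add_of_lt hk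
      simp only [u]
      rw [show k + j + 1 + 1 - k = j + 2 by omega, show k + j + 1 + 1 - (k + 2) = j by omega,
        show k + j + 1 + 1 - (k + 1) = j + 1 by omega]
      linear_combination (-r ^ k - ε * r ^ j) * hri
    · simp only [u, Nat.sub_self, Nat.add_sub_cancel_left]
      rw [pow_succ] at hroot ⊢
      linear_combination -ε * hroot - r ^ m * hri - r ^ m * r * (w - r) * hε2
  have hu0 : u 0 ≠ 0 := by
    have h1 : r ^ (m + 1) < 1 := pow_lt_one₀ hr0.le hr1 (by omega)
    have h2 : 0 < r ^ (m + 1) := by positivity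
    simp only [u, pow_zero, Nat.sub_zero]
    rcases hε with rfl | rfl <;> linarith
  have hdet : (Matrix.scalar (Fin (m + 2)) (r + r⁻¹) - pathA (m + 2) w).det = 0 := by
    rw [← Matrix.exists_mulVec_eq_zero_iff]
    refine ⟨fun i => u i, fun h => hu0 (congrFun h ⟨0, by omega⟩), ?_⟩
    rw [Matrix.sub_mulVec, hAu]
    ext i
    simp [Matrix.scalar_apply]
  rw [← Matrix.eval_charpoly, hμ.2, eval_prod, Finset.prod_eq_zero_iff] at hdet
  obtain ⟨i, -, hi⟩ := hdet
  refine ⟨i, ?_⟩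
  simp only [eval_sub, eval_X, eval_C] at hi
  linarith

theorem exists_boundary_root {m : ℕ} {w ρ ε : ℝ} (hw : 1 < w) (hρw : w⁻¹ < ρ) (hρ1 : ρ < 1)
    (hε : ε = 1 ∨ ε = -1) (hm : ρ ^ (m + 1) * w < w - ρ⁻¹) :
    ∃ r, 0 < r ∧ r < ρ ∧ r⁻¹ - w = ε * (r ^ (m + 1) * (w - r)) := by
  have hw0 : 0 < w := by linarith
  have hwi : 0 < w⁻¹ := inv_pos.mpr hw0
  have hρ0 : 0 < ρ := hwi.trans hρw
  have hwi1 : w⁻¹ < 1 := hρw.trans hρ1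
  have hbd : ∀ s : ℝ, 0 < s → s < 1 → |ε * (s ^ (m + 1) * (w - s))| ≤ s ^ (m + 1) * w := by
    intro s hs0 hs1
    have h1 : |ε| = 1 := by rcases hε with rfl | rfl <;> simp
    rw [abs_mul, h1, one_mul, abs_of_nonneg (mul_nonneg (by positivity) (by linarith))]
    gcongr
    linarith
  have hcont : ContinuousOn (fun r : ℝ => r⁻¹ - w - ε * (r ^ (m + 1) * (w - r)))
      (Set.Icc (w⁻¹ / 2) ρ) := by
    refine ContinuousOn.sub (ContinuousOn.sub (continuousOn_inv₀.mono fun x hx => ?_)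
      continuousOn_const) (by fun_prop)
    exact (lt_of_lt_of_le (by positivity) hx.1).ne'
  have hleft : 0 < (w⁻¹ / 2)⁻¹ - w - ε * ((w⁻¹ / 2) ^ (m + 1) * (w - w⁻¹ / 2)) := by
    have h1 := (abs_le.mp (hbd (w⁻¹ / 2) (by positivity) (by linarith))).2
    have h2 : (w⁻¹ / 2) ^ (m + 1) < 1 := pow_lt_one₀ (by positivity) (by linarith) (by omega)
    have h3 : (w⁻¹ / 2)⁻¹ = 2 * w := by field_simp
    nlinarith
  have hright : ρ⁻¹ - w - ε * (ρ ^ (m + 1) * (w - ρ)) < 0 := by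
    have h1 := (abs_le.mp (hbd ρ hρ0 hρ1)).1
    linarith
  obtain ⟨r, hr, hr'⟩ := intermediate_value_Icc' (by linarith) hcont ⟨hright.le, hleft.le⟩
  have hrρ : r ≠ ρ := by
    rintro rfl
    exact hright.ne hr'
  exact ⟨r, lt_of_lt_of_le (by positivity) hr.1, lt_of_le_of_ne hr.2 hrρ, sub_eq_zero.mp hr'⟩

/-- The second largest eigenvalue stays away from `2` once the order is large. -/
theorem IsEigList.add_inv_le_one {m : ℕ} {w ρ : ℝ} (hw : 1 < w) (hρw : w⁻¹ < ρ) (hρ1 : ρ < 1)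
    (hm : ρ ^ (m + 1) * w < w - ρ⁻¹) {μ : Fin (m + 2) → ℝ} (hμ : IsEigList (m + 2) w μ) :
    ρ + ρ⁻¹ ≤ μ ⟨1, by omega⟩ := by
  obtain ⟨r, hr0, hrρ, hr⟩ := exists_boundary_root hw hρw hρ1 (.inl rfl) hm
  obtain ⟨s, hs0, hsρ, hs⟩ := exists_boundary_root hw hρw hρ1 (.inr rfl) hm
  obtain ⟨i, hi⟩ := exists_eigList_eq hr0 (hrρ.trans hρ1) (.inl rfl) hr hμ
  obtain ⟨j, hj⟩ := exists_eigList_eq hs0 (hsρ.trans hρ1) (.inr rfl) hs hμ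
  have hne : i ≠ j := by
    rintro rfl
    have hrs : r = s := by
      rcases lt_trichotomy r s with h | h | h
      · linarith [add_inv_lt_add_inv hr0 h (hsρ.trans hρ1)]
      · exact h
      · linarith [add_inv_lt_add_inv hs0 h (hrρ.trans hρ1)]
    subst hrs
    have : 0 < r ^ (m + 1) * (w - r) := mul_pos (by positivity) (by linarith)
    linarith
  have hi' := add_inv_lt_add_inv hr0 hrρ hρ1
  have hj' := add_inv_lt_add_inv hs0 hsρ hρ1
  rcases Nat.eq_zero_or_pos i.val with h | h
  · have hjpos : 1 ≤ j.val := by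
      by_contra hcon
      exact hne (Fin.ext (by omega))
    have := hμ.1 (show (⟨1, by omega⟩ : Fin (m + 2)) ≤ j from hjpos)
    linarith
  · have := hμ.1 (show (⟨1, by omega⟩ : Fin (m + 2)) ≤ i from h)
    linarith

/-- The squared first entry of a unit eigenvector for an eigenvalue `r + r⁻¹`, `0 < r < 1`. -/
theorem sq_first_entry_eq {m : ℕ} {w r : ℝ} (hw : 1 < w) (hr0 : 0 < r) (hr1 : r < 1)
    {v : Fin (m + 2) → ℝ} (hv : ∑ i, v i ^ 2 = 1)
    (hAv : (pathA (m + 2) w).mulVec v = (r + r⁻¹) • v) :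
    |r⁻¹ - w| = r ^ (m + 1) * (w - r) ∧ ∃ ε : ℝ, |ε| = 1 ∧
      v ⟨0, by omega⟩ ^ 2 = (1 + ε * r ^ (m + 1)) ^ 2 /
        (2 * ((1 - (r ^ (m + 2)) ^ 2) / (1 - r ^ 2)) +
          2 * ε * (((m + 2 : ℕ) : ℝ) * r ^ (m + 1))) := by
  have hri : r * r⁻¹ = 1 := mul_inv_cancel₀ hr0.ne'
  have hd : 1 - r ^ 2 ≠ 0 := by nlinarith
  obtain ⟨u, rfl⟩ : ∃ u : ℕ → ℝ, v = fun i : Fin (m + 2) => u i := by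
    refine ⟨fun k => if h : k < m + 2 then v ⟨k, h⟩ else 0, ?_⟩
    ext i
    simp
  rw [pathA_mulVec_eq_smul_iff] at hAv
  obtain ⟨hfirst, hrec, hlast⟩ := hAv
  obtain ⟨a, b, hab⟩ := exists_geometric_of_recurrence hr0 hr1 hrec
  have hu0 : u 0 = a + b * r ^ (m + 1) := by simpa using hab 0 (by omega)
  have hu1 : u 1 = a * r + b * r ^ m := by simpa using hab 1 (by omega)
  have hum : u m = a * r ^ m + b * r := by simpa using hab m (by omega)
  have hum1 : u (m + 1) = a * r ^ (m + 1) + b := by simpa using hab (m + 1) (by omega)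
  rw [hu0, hu1] at hfirst
  rw [hum, hum1] at hlast
  set y := r ^ (m + 1) * (w - r) with hy
  have hypos : 0 < y := mul_pos (by positivity) (by linarith)
  have hax : a * (r⁻¹ - w) = b * y := by
    rw [hy]
    rw [pow_succ] at hfirst ⊢
    linear_combination -hfirst - b * r ^ m * hri
  have hbx : b * (r⁻¹ - w) = a * y := by
    rw [hy]
    rw [pow_succ] at hlast ⊢
    linear_combination -hlast - a * r ^ m * hri
  have hsum : a ^ 2 * ((1 - (r ^ (m + 2)) ^ 2) / (1 - r ^ 2)) +
      b ^ 2 * ((1 - (r ^ (m + 2)) ^ 2) / (1 - r ^ 2)) +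
      2 * a * b * (((m + 2 : ℕ) : ℝ) * r ^ (m + 1)) = 1 := by
    have hgeom : ∑ k ∈ Finset.range (m + 2), (r ^ 2) ^ k =
        (1 - (r ^ (m + 2)) ^ 2) / (1 - r ^ 2) := by
      rw [geom_sum_eq (by intro h; exact hd (by linarith)), ← neg_div_neg_eq, ← pow_mul,
        ← pow_mul, mul_comm 2]
      ring_nf
    have hterm : ∀ k ∈ Finset.range (m + 2), u k ^ 2 = a ^ 2 * (r ^ 2) ^ k +
        b ^ 2 * (r ^ 2) ^ (m + 2 - 1 - k) + 2 * a * b * r ^ (m + 1) := by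
      intro k hk
      rw [Finset.mem_range] at hk
      obtain ⟨j, hj⟩ := Nat.exists_eq_add_of_le (show k ≤ m + 1 by omega)
      rw [hab k (by omega), show m + 2 - 1 - k = j by omega, show m + 1 - k = j by omega, hj]
      ring
    rw [Fin.sum_univ_eq_sum_range (fun k => u k ^ 2), Finset.sum_congr rfl hterm,
      Finset.sum_add_distrib, Finset.sum_add_distrib, ← Finset.mul_sum, ← Finset.mul_sum,
      Finset.sum_range_reflect (fun k => (r ^ 2) ^ k), hgeom, Finset.sum_const,
      Finset.card_range, nsmul_eq_mul] at hv
    linear_combination hv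
  have hx : r⁻¹ - w ≠ 0 := by
    intro h
    rw [h, mul_zero] at hax hbx
    have hb : b = 0 := by simpa [hypos.ne'] using hax.symm
    have ha : a = 0 := by simpa [hypos.ne'] using hbx.symm
    simp [ha, hb] at hsum
  have hsq : a ^ 2 = b ^ 2 :=
    mul_right_cancel₀ hx (by linear_combination a * hax - b * hbx)
  have ha : a ≠ 0 := by
    rintro rfl
    have hb : b = 0 := by simpa using hsq.symm
    simp [hb] at hsum
  obtain ⟨ε, hε, rfl⟩ : ∃ ε : ℝ, |ε| = 1 ∧ b = ε * a := by
    rcases sq_eq_sq_iff_eq_or_eq_neg.mp hsq with h | h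
    · exact ⟨1, by simp, by linarith⟩
    · exact ⟨-1, by simp, by linarith⟩
  have hε2 : ε ^ 2 = 1 := by rw [← sq_abs, hε, one_pow]
  refine ⟨?_, ε, hε, ?_⟩
  · have : r⁻¹ - w = ε * y := mul_left_cancel₀ ha (by linear_combination hax)
    rw [this, abs_mul, hε, one_mul, abs_of_pos hypos]
  · set S := (1 - (r ^ (m + 2)) ^ 2) / (1 - r ^ 2)
    have hD : a ^ 2 * (2 * S + 2 * ε * (((m + 2 : ℕ) : ℝ) * r ^ (m + 1))) = 1 := by
      linear_combination hsum - a ^ 2 * S * hε2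
    have hD0 : 2 * S + 2 * ε * (((m + 2 : ℕ) : ℝ) * r ^ (m + 1)) ≠ 0 := by
      intro h
      rw [h, mul_zero] at hD
      exact zero_ne_one hD
    rw [eq_div_iff hD0]
    change u 0 ^ 2 * _ = _
    rw [hu0]
    linear_combination (1 + ε * r ^ (m + 1)) ^ 2 * hD

theorem tendsto_of_eventually_eq_sq_first_entry {w ρ : ℝ} (hw : 1 < w) (hρ0 : 0 < ρ)
    (hρ1 : ρ < 1) {s : ℕ → ℝ}
    (hs : ∀ᶠ n : ℕ in atTop, ∃ r ε : ℝ, 0 < r ∧ r ≤ ρ ∧ |ε| = 1 ∧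
      |r⁻¹ - w| = r ^ (n - 1) * (w - r) ∧ s n = (1 + ε * r ^ (n - 1)) ^ 2 /
        (2 * ((1 - (r ^ n) ^ 2) / (1 - r ^ 2)) + 2 * ε * ((n : ℝ) * r ^ (n - 1)))) :
    Tendsto s atTop (nhds ((w ^ 2 - 1) / (2 * w ^ 2))) := by
  have hw0 : 0 < w := by linarith
  have hw2 : w ^ 2 - 1 ≠ 0 := by nlinarith
  obtain ⟨r, hr⟩ := hs.choice
  obtain ⟨ε, hε⟩ := hr.choice
  have hp0 : Tendsto (fun n : ℕ => ρ ^ n) atTop (nhds 0) :=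
    tendsto_pow_atTop_nhds_zero_of_lt_one hρ0.le hρ1
  have hp : Tendsto (fun n : ℕ => ρ ^ (n - 1)) atTop (nhds 0) :=
    hp0.comp (tendsto_sub_atTop_nat 1)
  have hnp : Tendsto (fun n : ℕ => (n : ℝ) * ρ ^ (n - 1)) atTop (nhds 0) := by
    rw [← tendsto_add_atTop_iff_nat 1]
    have := (tendsto_self_mul_const_pow_of_lt_one hρ0.le hρ1).add hp0
    rw [add_zero] at this
    refine this.congr fun n => ?_
    rw [Nat.add_sub_cancel]
    push_cast
    ring
  have hrinv : Tendsto (fun n => (r n)⁻¹) atTop (nhds w) := by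
    rw [tendsto_iff_norm_sub_tendsto_zero]
    refine squeeze_zero' (.of_forall fun n => norm_nonneg _) ?_
      (by simpa using hp.mul_const w)
    filter_upwards [hε] with n ⟨h0, h1, _, h3, _⟩
    rw [Real.norm_eq_abs, h3]
    have : r n ^ (n - 1) ≤ ρ ^ (n - 1) := by gcongr
    have : 0 < r n ^ (n - 1) := by positivity
    have : 0 < w - r n := by linarith
    gcongr
    linarith
  have hrlim : Tendsto r atTop (nhds w⁻¹) := by
    simpa using hrinv.inv₀ hw0.ne'
  have hrn : Tendsto (fun n => r n ^ n) atTop (nhds 0) := by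
    refine squeeze_zero' ?_ ?_ hp0
    · filter_upwards [hε] with n h
      exact pow_nonneg h.1.le _
    · filter_upwards [hε] with n h
      exact pow_le_pow_left₀ h.1.le h.2.1 _
  have hεr : Tendsto (fun n => ε n * r n ^ (n - 1)) atTop (nhds 0) := by
    refine squeeze_zero_norm' ?_ hp
    filter_upwards [hε] with n h
    rw [norm_mul, Real.norm_eq_abs, h.2.2.1, one_mul, norm_pow, Real.norm_of_nonneg h.1.le]
    exact pow_le_pow_left₀ h.1.le h.2.1 _
  have hεnr : Tendsto (fun n : ℕ => ε n * ((n : ℝ) * r n ^ (n - 1))) atTop (nhds 0) := by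
    refine squeeze_zero_norm' ?_ hnp
    filter_upwards [hε] with n h
    rw [norm_mul, Real.norm_eq_abs, h.2.2.1, one_mul, norm_mul, norm_pow,
      Real.norm_of_nonneg h.1.le, Real.norm_natCast]
    exact mul_le_mul_of_nonneg_left (pow_le_pow_left₀ h.1.le h.2.1 _) n.cast_nonneg
  have hden : 1 - w⁻¹ ^ 2 ≠ 0 := by
    field_simp
    exact div_ne_zero hw2 (by positivity)
  have hS := (((hrn.pow 2).const_sub 1).div ((hrlim.pow 2).const_sub 1) hden).const_mul 2
  have hlim := ((hεr.const_add 1).pow 2).div (hS.add (hεnr.const_mul 2))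
    (by simpa using hden)
  have hval : (1 + 0 : ℝ) ^ 2 / (2 * ((1 - 0 ^ 2) / (1 - w⁻¹ ^ 2)) + 2 * 0) =
      (w ^ 2 - 1) / (2 * w ^ 2) := by
    field_simp
    norm_num
  rw [hval] at hlim
  refine hlim.congr' ?_
  filter_upwards [hε] with n h
  rw [h.2.2.2.2, mul_assoc 2 (ε n)]
  rfl

theorem tendsto_sq_first_entry {w : ℝ} (hw : 1 < w) {s : ℕ → ℝ}
    (hs : ∀ m : ℕ, ∃ (μ : Fin (m + 3) → ℝ) (v : Fin (m + 3) → ℝ) (k : Fin (m + 3)),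
      IsEigList (m + 3) w μ ∧ k ≤ ⟨1, by omega⟩ ∧ (∑ i, v i ^ 2 = 1) ∧
      (pathA (m + 3) w).mulVec v = μ k • v ∧ s (m + 3) = v ⟨0, by omega⟩ ^ 2) :
    Tendsto s atTop (nhds ((w ^ 2 - 1) / (2 * w ^ 2))) := by
  have hw0 : 0 < w := by linarith
  obtain ⟨ρ, hρw, hρ1⟩ := exists_between (inv_lt_one_of_one_lt₀ hw)
  have hρ0 : 0 < ρ := (inv_pos.mpr hw0).trans hρw
  have hgap : 0 < w - ρ⁻¹ := by
    have := (inv_lt_comm₀ hw0 hρ0).mp hρw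
    linarith
  have hsmall : ∀ᶠ n : ℕ in atTop, ρ ^ (n - 1) * w < w - ρ⁻¹ := by
    have h := (((tendsto_pow_atTop_nhds_zero_of_lt_one hρ0.le hρ1).comp
      (tendsto_sub_atTop_nat 1)).mul_const w)
    rw [zero_mul] at h
    exact h.eventually_lt_const hgap
  refine tendsto_of_eventually_eq_sq_first_entry hw hρ0 hρ1 ?_
  filter_upwards [hsmall, eventually_ge_atTop 3] with n hn h3
  obtain ⟨m, rfl⟩ := Nat.exists_eq_add_of_le' h3
  obtain ⟨μ, v, k, hμ, hk, hv, hAv, hsv⟩ := hs m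
  obtain ⟨r, hr0, hrρ, hr⟩ := exists_add_inv_eq hρ0
    ((IsEigList.add_inv_le_one (m := m + 1) hw hρw hρ1 hn hμ).trans (hμ.1 hk))
  rw [← hr] at hAv
  obtain ⟨hbd, ε, hε, heq⟩ := sq_first_entry_eq (m := m + 1) hw hr0 (hrρ.trans_lt hρ1) hv hAv
  exact ⟨r, ε, hr0, hrρ, hε, hbd, hsv.trans heq⟩

/-- For fixed `w > 1`, the squared first entries of unit eigenvectors of `A(w)` (of
order `n`) for its two largest eigenvalues both converge to `(w²−1)/(2w²)` as
`n → ∞`.  Here `s1 n` (resp. `s2 n`) records `v₁₁(n)²` (resp. `v₁₂(n)²`). -/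
theorem evec_limit (w : ℝ) (hw : 1 < w) (s1 s2 : ℕ → ℝ)
    (h1 : ∀ (n : ℕ) (hn : 3 ≤ n), ∃ (μ : Fin n → ℝ) (v : Fin n → ℝ),
      IsEigList n w μ ∧ (∑ i, v i ^ 2 = 1) ∧
      (pathA n w).mulVec v = μ ⟨0, by omega⟩ • v ∧ s1 n = v ⟨0, by omega⟩ ^ 2)
    (h2 : ∀ (n : ℕ) (hn : 3 ≤ n), ∃ (μ : Fin n → ℝ) (v : Fin n → ℝ),
      IsEigList n w μ ∧ (∑ i, v i ^ 2 = 1) ∧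
      (pathA n w).mulVec v = μ ⟨1, by omega⟩ • v ∧ s2 n = v ⟨0, by omega⟩ ^ 2) :
    Tendsto s1 atTop (nhds ((w ^ 2 - 1) / (2 * w ^ 2))) ∧
    Tendsto s2 atTop (nhds ((w ^ 2 - 1) / (2 * w ^ 2))) := by
  constructor
  · refine tendsto_sq_first_entry hw fun m => ?_
    obtain ⟨μ, v, hμ, hv, hAv, hs⟩ := h1 (m + 3) (by omega)
    exact ⟨μ, v, ⟨0, by omega⟩, hμ, Fin.mk_le_mk.mpr zero_le_one, hv, hAv, hs⟩
  · refine tendsto_sq_first_entry hw fun m => ?_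
    obtain ⟨μ, v, hμ, hv, hAv, hs⟩ := h2 (m + 3) (by omega)
    exact ⟨μ, v, ⟨1, by omega⟩, hμ, le_rfl, hv, hAv, hs⟩
end

section
/- Let λ > 2 and define f(x) = (sin x / (λ − 2cos x))² for x ∈ [0, π]. Then for every odd integer n ≥ 3, | (2π/(n−1)) · Σ_{ℓ=1}^{⌊(n−1)/2⌋} f((2ℓ−1)π/(n−1)) − (π/4)(λ/√(λ²−4) − 1) | ≤ 4π/((n−1)(λ²−4)), and for every even integer n ≥ 4, | (2π/(n−1)) · Σ_{ℓ=1}^{⌊(n−2)/2⌋} f(2ℓπ/(n−1)) − (π/4)(λ/√(λ²−4) − 1) | ≤ 4π/((n−1)(λ²−4)). -/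
open Real Filter

/-- If `G` is an antiderivative of `f` and, on `[0, c]`, the oscillation of `f` is controlled by the monotone function `V`,
then on any subinterval the one-point quadrature of `f` approximates the increment of `G` to within
the length of the subinterval times the increment of `V`. -/
lemma abs_sub_le_of_tagged {f G V : ℝ → ℝ} {c : ℝ} (hG : ∀ x, HasDerivAt G (f x) x)
    (hV : MonotoneOn V (Set.Icc 0 c))
    (hfV : ∀ x ∈ Set.Icc 0 c, ∀ y ∈ Set.Icc 0 c, |f x - f y| ≤ |V x - V y|)
    {a b x : ℝ} (ha : 0 ≤ a) (hab : a < b) (hb : b ≤ c) (hx : x ∈ Set.Icc a b) :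
    |(b - a) * f x - (G b - G a)| ≤ (b - a) * (V b - V a) := by
  obtain ⟨y, hy, hGy⟩ := exists_hasDerivAt_eq_slope G f hab
    (fun z _ => (hG z).continuousAt.continuousWithinAt) (fun z _ => hG z)
  have hba : 0 < b - a := sub_pos.2 hab
  have hGb : G b - G a = (b - a) * f y := by rw [hGy]; field_simp
  have mem : ∀ {z}, a ≤ z → z ≤ b → z ∈ Set.Icc 0 c := fun h₁ h₂ => ⟨ha.trans h₁, h₂.trans hb⟩
  have hx' := mem hx.1 hx.2
  have hy' := mem hy.1.le hy.2.le
  have ha' := mem le_rfl hab.le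
  have hb' := mem hab.le le_rfl
  rw [hGb, ← mul_sub, abs_mul, abs_of_pos hba]
  refine mul_le_mul_of_nonneg_left ((hfV x hx' y hy').trans (abs_le.2 ⟨?_, ?_⟩)) hba.le
  · linarith [hV ha' hx' hx.1, hV hy' hb' hy.2.le]
  · linarith [hV ha' hy' hy.1.le, hV hx' hb' hx.2]

/-- Tagged Riemann sums of `f` with mesh `h` approximate the increment of `G` to within `h` times the
increment of `V`. -/
lemma abs_riemann_sum_sub_le {f G V : ℝ → ℝ} {c h : ℝ} (hG : ∀ x, HasDerivAt G (f x) x)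
    (hV : MonotoneOn V (Set.Icc 0 c))
    (hfV : ∀ x ∈ Set.Icc 0 c, ∀ y ∈ Set.Icc 0 c, |f x - f y| ≤ |V x - V y|)
    (hh : 0 < h) (t : ℕ → ℝ) (ht : ∀ k : ℕ, t (k + 1) ∈ Set.Icc (k * h) ((k + 1) * h))
    (m : ℕ) (hm : m * h ≤ c) :
    |h * ∑ k ∈ Finset.Icc 1 m, f (t k) - (G (m * h) - G 0)| ≤ h * (V (m * h) - V 0) := by
  induction m with
  | zero => simp
  | succ m ih =>
    push_cast at hm ⊢
    have ih := ih (by linarith)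
    have step := abs_sub_le_of_tagged hG hV hfV (a := m * h) (by positivity)
      (by linarith) hm (ht m)
    rw [show (m + 1) * h - m * h = h by ring] at step
    rw [Finset.sum_Icc_succ_top (by omega)]
    rw [abs_le] at *
    constructor <;> linarith [ih.1, ih.2, step.1, step.2]

/-- The square of `x ↦ sin x / (lam - 2 cos x)` has an elementary antiderivative. -/
lemma exists_antideriv_sq_sin_div {lam : ℝ} (hlam : 2 < lam) :
    ∃ G : ℝ → ℝ, (∀ x, HasDerivAt G ((sin x / (lam - 2 * cos x)) ^ 2) x) ∧
      G π - G 0 = π / 4 * (lam / √(lam ^ 2 - 4) - 1) := by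
  set d := √(lam ^ 2 - 4) with hd
  have hd0 : 0 < d := sqrt_pos.2 (by nlinarith)
  have hd2 : d ^ 2 = lam ^ 2 - 4 := sq_sqrt (by nlinarith)
  obtain ⟨r, hr⟩ : ∃ r, r = (lam - d) / 2 := ⟨_, rfl⟩
  have hdr : d = lam - 2 * r := by linarith
  have hr2 : r ^ 2 = lam * r - 1 := by rw [hdr] at hd2; linarith
  have hr0 : 0 < r := by nlinarith
  have hr1 : r < 1 := by nlinarith
  have hD : ∀ x, 0 < lam - 2 * cos x := fun x => by linarith [cos_le_one x]
  have hE : ∀ x, 0 < 1 - r * cos x := fun x => by nlinarith [cos_le_one x]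
  have hH : ∀ x, HasDerivAt (fun x => x + 2 * arctan (r * sin x / (1 - r * cos x)))
      (d / (lam - 2 * cos x)) x := by
    intro x
    have h₁ : HasDerivAt (fun x => r * sin x / (1 - r * cos x)) _ x :=
      ((hasDerivAt_sin x).const_mul r).fun_div
        (((hasDerivAt_cos x).const_mul r).const_sub 1) (hE x).ne'
    refine ((hasDerivAt_id x).add ((h₁.arctan).const_mul 2)).congr_deriv ?_
    have hx := (hE x).ne'
    have hy := (hD x).ne'
    have key : (1 - r * cos x) ^ 2 + (r * sin x) ^ 2 = r * (lam - 2 * cos x) := by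
      linear_combination r ^ 2 * sin_sq_add_cos_sq x + hr2
    have h₂ : 1 + (r * sin x / (1 - r * cos x)) ^ 2
        = r * (lam - 2 * cos x) / (1 - r * cos x) ^ 2 := by
      rw [← key]; field_simp
    rw [h₂, hdr]
    field_simp
    linear_combination (-2 * r) * sin_sq_add_cos_sq x
  have hK : ∀ x, HasDerivAt (fun x => sin x / (lam - 2 * cos x))
      ((cos x * (lam - 2 * cos x) - 2 * sin x ^ 2) / (lam - 2 * cos x) ^ 2) x := by
    intro x
    refine ((hasDerivAt_sin x).fun_div
      (((hasDerivAt_cos x).const_mul 2).const_sub lam) (hD x).ne').congr_deriv ?_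
    ring
  refine ⟨fun x => lam / (4 * d) * (x + 2 * arctan (r * sin x / (1 - r * cos x))) - x / 4
    - sin x / (lam - 2 * cos x) / 2, fun x => ?_, ?_⟩
  · refine ((((hH x).const_mul _).sub ((hasDerivAt_id x).div_const 4)).sub
      ((hK x).div_const 2)).congr_deriv ?_
    have hy := (hD x).ne'
    field_simp
    ring
  · simp
    field_simp

/-- On `[0, π]` the function `(sin x / (lam - 2 cos x)) ^ 2` has total variation at most
`2 / (lam ^ 2 - 4)`. -/
lemma exists_variation_sq_sin_div {lam : ℝ} (hlam : 2 < lam) :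
    ∃ V : ℝ → ℝ, MonotoneOn V (Set.Icc 0 π) ∧
      (∀ x ∈ Set.Icc 0 π, ∀ y ∈ Set.Icc 0 π,
        |(sin x / (lam - 2 * cos x)) ^ 2 - (sin y / (lam - 2 * cos y)) ^ 2| ≤ |V x - V y|) ∧
      V π - V 0 = 2 / (lam ^ 2 - 4) := by
  have hM : 0 < lam ^ 2 - 4 := by nlinarith
  have hD : ∀ x, 0 < lam - 2 * cos x := fun x => by linarith [cos_le_one x]
  obtain ⟨u, hu⟩ : ∃ u : ℝ → ℝ, u = fun x => (lam * cos x - 2) / (lam - 2 * cos x) := ⟨_, rfl⟩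
  have hf : ∀ x, (sin x / (lam - 2 * cos x)) ^ 2 = (1 - u x ^ 2) / (lam ^ 2 - 4) := by
    intro x
    have hy := (hD x).ne'
    rw [hu]
    field_simp
    linear_combination (lam ^ 2 - 4) * sin_sq_add_cos_sq x
  have hanti : AntitoneOn u (Set.Icc 0 π) := by
    intro x hx y hy hxy
    have hc := strictAntiOn_cos.antitoneOn hx hy hxy
    rw [hu]
    simp only
    rw [div_le_div_iff₀ (hD y) (hD x)]
    nlinarith
  have habs : Monotone fun s : ℝ => s * |s| := by
    intro a b hab
    simp only
    rcases abs_cases a with ⟨h, _⟩ | ⟨h, _⟩ <;> rcases abs_cases b with ⟨h', _⟩ | ⟨h', _⟩ <;>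
      rw [h, h'] <;> nlinarith
  refine ⟨fun x => (1 - u x * |u x|) / (lam ^ 2 - 4), ?_, ?_, ?_⟩
  · intro x hx y hy hxy
    have := habs (hanti hx hy hxy)
    simp only at this ⊢
    gcongr
  · intro x _ y _
    rw [hf, hf, ← sub_div, ← sub_div, abs_div, abs_div]
    refine div_le_div_of_nonneg_right ?_ (abs_nonneg _)
    generalize u x = a
    generalize u y = b
    have h₁ : 1 - a ^ 2 - (1 - b ^ 2) = |b| ^ 2 - |a| ^ 2 := by simp
    have h₂ : 1 - a * |a| - (1 - b * |b|) = b * |b| - a * |a| := by ring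
    rw [h₁, h₂]
    rcases abs_cases a with ⟨h, _⟩ | ⟨h, _⟩ <;> rcases abs_cases b with ⟨h', _⟩ | ⟨h', _⟩ <;>
      rw [h, h', ← sq_le_sq] <;> nlinarith [mul_nonneg (sq_nonneg a) (sq_nonneg b)]
  · have h0 : u 0 = 1 := by
      rw [hu]; simp only [cos_zero, mul_one]; exact div_self (by linarith)
    have hpi : u π = -1 := by
      rw [hu]; simp only [cos_pi]; rw [div_eq_iff (by linarith)]; ring
    simp only [h0, hpi, abs_neg, abs_one]
    ring

/-- Riemann-sum estimates for `f(x) = (sin x/(λ − 2cos x))²`: for odd `n ≥ 3` and for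
even `n ≥ 4`, the stated sums are within `4π/((n−1)(λ²−4))` of
`(π/4)(λ/√(λ²−4) − 1)`.  Here `⌊(n−1)/2⌋` and `⌊(n−2)/2⌋` are natural-number
divisions. -/
theorem riemann_estimates (lam : ℝ) (hlam : 2 < lam) :
    (∀ n : ℕ, 3 ≤ n → Odd n →
      |2 * π / ((n : ℝ) - 1) * ∑ ℓ ∈ Finset.Icc 1 ((n - 1) / 2),
          (Real.sin ((2 * (ℓ : ℝ) - 1) * π / ((n : ℝ) - 1)) /
            (lam - 2 * Real.cos ((2 * (ℓ : ℝ) - 1) * π / ((n : ℝ) - 1)))) ^ 2 -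
        π / 4 * (lam / Real.sqrt (lam ^ 2 - 4) - 1)|
      ≤ 4 * π / (((n : ℝ) - 1) * (lam ^ 2 - 4))) ∧
    (∀ n : ℕ, 4 ≤ n → Even n →
      |2 * π / ((n : ℝ) - 1) * ∑ ℓ ∈ Finset.Icc 1 ((n - 2) / 2),
          (Real.sin (2 * (ℓ : ℝ) * π / ((n : ℝ) - 1)) /
            (lam - 2 * Real.cos (2 * (ℓ : ℝ) * π / ((n : ℝ) - 1)))) ^ 2 -
        π / 4 * (lam / Real.sqrt (lam ^ 2 - 4) - 1)|
      ≤ 4 * π / (((n : ℝ) - 1) * (lam ^ 2 - 4))) := by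
  obtain ⟨G, hG, hGpi⟩ := exists_antideriv_sq_sin_div hlam
  obtain ⟨V, hV, hfV, hVpi⟩ := exists_variation_sq_sin_div hlam
  have hM : 0 < lam ^ 2 - 4 := by nlinarith
  have hπ := pi_pos
  refine ⟨?_, ?_⟩
  · rintro n hn ⟨k, rfl⟩
    have hk : (0 : ℝ) < k := by exact_mod_cast (by omega : 0 < k)
    have key := abs_riemann_sum_sub_le hG hV hfV (h := π / k) (by positivity)
      (fun l : ℕ => (2 * (l : ℝ) - 1) * π / (2 * k))
      (fun l => by
        push_cast
        constructor
        · rw [← mul_div_assoc, div_le_div_iff₀ hk (by positivity)]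
          nlinarith [mul_pos hπ hk]
        · rw [← mul_div_assoc, div_le_div_iff₀ (by positivity) hk]
          nlinarith [mul_pos hπ hk]) k (by field_simp; rfl)
    rw [mul_div_cancel₀ _ hk.ne', hGpi, hVpi] at key
    have hN : ((2 * k + 1 : ℕ) : ℝ) - 1 = 2 * k := by push_cast; ring
    rw [hN, show (2 * k + 1 - 1) / 2 = k by omega, mul_div_mul_left π (k : ℝ) two_ne_zero]
    refine key.trans_eq ?_
    field_simp
    ring
  · rintro n hn ⟨j, rfl⟩
    obtain ⟨k, rfl⟩ : ∃ k, j = k + 1 := ⟨j - 1, by omega⟩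
    have hN : ((k + 1 + (k + 1) : ℕ) : ℝ) - 1 = 2 * k + 1 := by push_cast; ring
    have hk : (0 : ℝ) < 2 * k + 1 := by positivity
    rw [hN, show (k + 1 + (k + 1) - 2) / 2 = k by omega]
    obtain ⟨h, hh⟩ : ∃ h, h = 2 * π / (2 * (k : ℝ) + 1) := ⟨_, rfl⟩
    have hh0 : 0 < h := by rw [hh]; positivity
    have hπh : π - k * h = h / 2 := by rw [hh]; field_simp; ring
    have hbound : 4 * π / ((2 * (k : ℝ) + 1) * (lam ^ 2 - 4)) = h * (2 / (lam ^ 2 - 4)) := by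
      rw [hh]; field_simp; ring
    have key := abs_riemann_sum_sub_le hG hV hfV hh0
      (fun l : ℕ => 2 * (l : ℝ) * π / (2 * k + 1))
      (fun l => by
        have : 2 * ((l : ℝ) + 1) * π / (2 * k + 1) = (l + 1) * h := by rw [hh]; ring
        push_cast
        rw [this]
        constructor <;> linarith) k (by linarith)
    have last := abs_sub_le_of_tagged hG hV hfV (a := k * h) (b := π) (x := π) (by positivity)
      (by linarith) le_rfl ⟨by linarith, le_rfl⟩
    have hmono := hV (a := k * h) ⟨by positivity, by linarith⟩ ⟨hπ.le, le_rfl⟩ (by linarith)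
    have hhalf : h / 2 * (V π - V (k * h)) ≤ h * (V π - V (k * h)) :=
      mul_le_mul_of_nonneg_right (by linarith) (by linarith)
    simp only [sin_pi, zero_div, ne_eq, OfNat.ofNat_ne_zero, not_false_eq_true, zero_pow,
      mul_zero, zero_sub, hπh] at last
    rw [hbound, ← hGpi, ← hVpi, ← hh]
    rw [abs_le] at *
    constructor <;> linarith [key.1, key.2, last.1, last.2]
end
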